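/- For each integer r ≥ 2 there exist d₀(r) and c(r) > 0 such that for all d ≥ d₀: every graph G with maximum degree at most d and chromatic number at most r satisfies sd⁽³⁾(G) ≤ d − ⌊c·√(d log d)⌋, and hence χ_DPP(G) ≤ d − ⌊c·√(d log d)⌋. -/

import Mathlib

open scoped Classical in
/-- Strict type 3 degeneracy of a pair `(G, f)`: an edgeless graph with positive-valued `f`
is strict type 3 degenerate, and otherwise one may apply `ReduceValue` at a vertex
(decrease `f v` by one) or `EdgeDelete` at an edge `vw` (delete the edge and decrease
`f v` by `f w`). -/
inductive SD3 {V : Type*} : SimpleGraph V → (V → ℕ) → Prop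
  | base (G : SimpleGraph V) (f : V → ℕ) (h : ∀ v w, ¬ G.Adj v w) (hpos : ∀ v, 1 ≤ f v) :
      SD3 G f
  | reduce (G : SimpleGraph V) (f : V → ℕ) (v : V)
      (h : SD3 G (Function.update f v (f v - 1))) : SD3 G f
  | edgeDel (G : SimpleGraph V) (f : V → ℕ) (v w : V) (hvw : G.Adj v w)
      (h : SD3 (G.deleteEdges {s(v, w)}) (Function.update f v (f v - f w))) : SD3 G f

/-- The strict type 3 degeneracy `sd³(G)`: the least constant `k` making `(G, k)`
strict type 3 degenerate. -/
noncomputable def sd3 {V : Type*} (G : SimpleGraph V) : ℕ :=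
  sInf {k : ℕ | SD3 G (fun _ => k)}

open scoped Classical in
/-- `DPPaintN G n U f`: Painter can win the DP-painting game within `n` turns, where `U` is
the set of unmarked vertices and `f v` is the number of tokens at `v`. On each turn Lister
removes `g v ≤ f v` tokens from each vertex (at least one token in total) and presents a
cover graph `A` on `V × ℕ` whose list at `v` is `{v} × {0, …, g v - 1}`: lists are cliques,
edges between distinct lists only join adjacent vertices of `G` and form a matching.
Painter picks an independent set `I` of the cover graph, marking the underlying vertices;
Painter loses if an unmarked vertex runs out of tokens. -/
def DPPaintN {V : Type*} (G : SimpleGraph V) : ℕ → Finset V → (V → ℕ) → Prop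
  | 0, U, _ => U = ∅
  | n + 1, U, f => U = ∅ ∨
      ((∀ v ∈ U, 1 ≤ f v) ∧
        ∀ g : V → ℕ, (∀ v, g v ≤ f v) → (∃ v, 1 ≤ g v) →
        ∀ A : (V × ℕ) → (V × ℕ) → Prop, Symmetric A → (∀ p, ¬ A p p) →
          (∀ u a v b, A (u, a) (v, b) → a < g u ∧ b < g v) →
          (∀ u a v b, A (u, a) (v, b) → u ≠ v → G.Adj u v) →
          (∀ u a b, a < g u → b < g u → a ≠ b → A (u, a) (u, b)) →
          (∀ u v, u ≠ v → ∀ a b c, A (u, a) (v, b) → A (u, a) (v, c) → b = c) →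
          ∃ I : Finset (V × ℕ),
            (∀ p ∈ I, p.2 < g p.1) ∧
            (∀ p ∈ I, ∀ q ∈ I, ¬ A p q) ∧
            DPPaintN G n (U \ I.image Prod.fst) (fun v => f v - g v))

/-- Painter has a winning strategy in the DP-painting game (which necessarily ends in
finitely many turns, since each turn removes at least one token). -/
def DPPaint {V : Type*} (G : SimpleGraph V) (U : Finset V) (f : V → ℕ) : Prop :=
  ∃ n : ℕ, DPPaintN G n U f

/-- The DP-paintability `χ_DPP(G)`: the least `k` such that Painter wins the
DP-`k`-painting game. -/
noncomputable def chiDPP {V : Type*} [Fintype V] (G : SimpleGraph V) : ℕ :=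
  sInf {k : ℕ | DPPaint G Finset.univ (fun _ => k)}

section
open scoped Classical
open Finset

/-- A deletion scheme: the vertices of `U` are removed one at a time. Removing `u` decreases
the value of each remaining neighbour by one, except for the neighbours in a set `S` of saved
vertices, whose total value must be less than the value of `u`. -/
inductive DelSave {V : Type*} (G : SimpleGraph V) : Finset V → (V → ℕ) → Prop
  | empty (f : V → ℕ) : DelSave G ∅ f
  | mono {U : Finset V} {f f' : V → ℕ} (h : DelSave G U f') (hle : ∀ v ∈ U, f' v ≤ f v) :
      DelSave G U f
  | step {U : Finset V} {f : V → ℕ} (u : V) (S : Finset V) (hu : u ∉ U) (hS : S ⊆ U)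
      (hlt : ∑ w ∈ S, f w < f u)
      (h : DelSave G U (fun w => if G.Adj u w ∧ w ∉ S then f w - 1 else f w)) :
      DelSave G (insert u U) f

variable {V : Type*} {G : SimpleGraph V}

theorem DelSave.pos {U : Finset V} {f : V → ℕ} (h : DelSave G U f) : ∀ v ∈ U, 1 ≤ f v := by
  induction h with
  | empty f => simp
  | mono h hle ih => exact fun v hv => (ih v hv).trans (hle v hv)
  | step u S hu hS hlt h ih =>
    intro v hv
    rcases Finset.mem_insert.1 hv with rfl | hv
    · omega
    · have := ih v hv
      dsimp only at this
      split_ifs at this <;> omega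

/-! ### Deletion schemes are instances of strict type 3 degeneracy -/

theorem SD3.mono [Fintype V] {G : SimpleGraph V} {f' : V → ℕ} (h : SD3 G f') :
    ∀ f : V → ℕ, f' ≤ f → SD3 G f := by
  suffices H : ∀ n : ℕ, ∀ f : V → ℕ, f' ≤ f → ∑ v, f v = ∑ v, f' v + n → SD3 G f by
    intro f hf
    obtain ⟨n, hn⟩ := Nat.exists_eq_add_of_le (Finset.sum_le_sum fun v (_ : v ∈ univ) => hf v)
    exact H n f hf hn
  intro n
  induction n with
  | zero =>
    intro f hf hs
    have : f' = f := by
      funext v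
      exact (Finset.sum_eq_sum_iff_of_le fun v (_ : v ∈ univ) => hf v).1 (by omega) v (mem_univ v)
    exact this ▸ h
  | succ n ih =>
    intro f hf hs
    obtain ⟨v, -, hv⟩ : ∃ v ∈ univ, f' v < f v :=
      Finset.exists_lt_of_sum_lt (by omega)
    refine SD3.reduce G f v (ih _ ?_ ?_)
    · intro w
      by_cases hw : w = v
      · subst hw; simp; omega
      · simpa [hw] using hf w
    · have h1 := Finset.add_sum_erase univ f (mem_univ v)
      have h2 := Finset.add_sum_erase univ (Function.update f v (f v - 1)) (mem_univ v)
      have h3 : ∑ w ∈ univ.erase v, Function.update f v (f v - 1) w = ∑ w ∈ univ.erase v, f w :=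
        Finset.sum_congr rfl fun w hw => by simp [Finset.ne_of_mem_erase hw]
      simp only [Function.update_self] at h2
      omega

/-- The edges joining `u` to the vertices of `T`. -/
def starEdges (u : V) (T : Finset V) : Set (Sym2 V) := {e | ∃ w ∈ T, e = s(u, w)}

theorem starEdges_insert (u a : V) (T : Finset V) :
    starEdges u (insert a T) = {s(u, a)} ∪ starEdges u T := by
  ext e; simp [starEdges]

theorem adj_deleteEdges_singleton {H : SimpleGraph V} {u a w : V} (hw : H.Adj u w)
    (hne : w ≠ a) : (H.deleteEdges {s(u, a)}).Adj u w := by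
  simp only [SimpleGraph.deleteEdges_adj, Set.mem_singleton_iff]
  refine ⟨hw, ?_⟩
  rw [Sym2.congr_right]
  exact hne

theorem SD3.of_save_star (u : V) (T : Finset V) (hu : u ∉ T) :
    ∀ (H : SimpleGraph V) (f : V → ℕ), (∀ w ∈ T, H.Adj u w) →
      SD3 (H.deleteEdges (starEdges u T)) (Function.update f u (f u - ∑ w ∈ T, f w)) →
      SD3 H f := by
  induction T using Finset.induction_on with
  | empty => intro H f _ h; simpa [starEdges] using h
  | insert a T ha ih =>
    intro H f hT h
    rw [Finset.mem_insert, not_or] at hu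
    refine SD3.edgeDel H f u a (hT a (mem_insert_self _ _)) (ih hu.2 _ _ ?_ ?_)
    · intro w hw
      exact adj_deleteEdges_singleton (hT w (mem_insert_of_mem hw)) fun e => ha (e ▸ hw)
    · rw [SimpleGraph.deleteEdges_deleteEdges, ← starEdges_insert]
      have hs : ∑ w ∈ T, Function.update f u (f u - f a) w = ∑ w ∈ T, f w :=
        Finset.sum_congr rfl fun w hw => by
          rw [Function.update_of_ne]; rintro rfl; exact hu.2 hw
      rw [Finset.sum_insert ha] at h
      rw [hs, Function.update_self, Function.update_idem, Nat.sub_sub]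
      exact h

theorem SD3.of_delete_star (u : V) (T : Finset V) (hu : u ∉ T) :
    ∀ (H : SimpleGraph V) (f : V → ℕ), (∀ w ∈ T, H.Adj u w) → f u = 1 →
      SD3 (H.deleteEdges (starEdges u T)) (fun w => if w ∈ T then f w - 1 else f w) →
      SD3 H f := by
  induction T using Finset.induction_on with
  | empty => intro H f _ _ h; simpa [starEdges] using h
  | insert a T ha ih =>
    intro H f hT hf h
    rw [Finset.mem_insert, not_or] at hu
    refine SD3.edgeDel H f a u (hT a (mem_insert_self _ _)).symm (ih hu.2 _ _ ?_ ?_ ?_)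
    · intro w hw
      rw [Sym2.eq_swap]
      exact adj_deleteEdges_singleton (hT w (mem_insert_of_mem hw)) fun e => ha (e ▸ hw)
    · rwa [Function.update_of_ne hu.1]
    · rw [Sym2.eq_swap, SimpleGraph.deleteEdges_deleteEdges, ← starEdges_insert]
      convert h using 2 with w
      by_cases hw : w = a
      · subst hw; simp [ha, hf]
      · simp [hw]

theorem DelSave.sd3_aux [Fintype V] {U : Finset V} {f : V → ℕ} (h : DelSave G U f) :
    ∀ (H : SimpleGraph V) (f' : V → ℕ), (∀ v w, H.Adj v w ↔ G.Adj v w ∧ v ∈ U ∧ w ∈ U) →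
      (∀ v ∈ U, f' v = f v) → (∀ v ∉ U, 1 ≤ f' v) → SD3 H f' := by
  induction h with
  | empty f =>
    intro H f' hH _ hpos
    exact SD3.base H f' (fun v w => by simp [hH]) (fun v => hpos v (by simp))
  | @mono U f f₁ h hle ih =>
    intro H f' hH hU hpos
    refine SD3.mono (ih H (fun v => if v ∈ U then f₁ v else f' v) hH ?_ ?_) f' ?_
    · intro v hv; simp [hv]
    · intro v hv; simpa [hv] using hpos v hv
    · intro v
      by_cases hv : v ∈ U
      · simpa [hv, hU v hv] using hle v hv
      · simp [hv]
  | @step U f u S hu hS hlt h ih =>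
    intro H f' hH hU hpos
    have huU := hU u (mem_insert_self _ _)
    have hUU : ∀ v ∈ U, f' v = f v := fun v hv => hU v (mem_insert_of_mem hv)
    have hadj : ∀ w, H.Adj u w ↔ G.Adj u w ∧ w ∈ U := by
      intro w
      rw [hH]
      constructor
      · rintro ⟨h1, -, h3⟩
        exact ⟨h1, (mem_insert.1 h3).resolve_left h1.ne'⟩
      · rintro ⟨h1, h3⟩
        exact ⟨h1, mem_insert_self _ _, mem_insert_of_mem h3⟩
    set T₁ := S.filter (G.Adj u) with hT₁
    set T₂ := U.filter (fun w => G.Adj u w ∧ w ∉ S) with hT₂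
    have hT₁S : ∑ w ∈ T₁, f' w ≤ ∑ w ∈ S, f w :=
      (Finset.sum_le_sum_of_subset (filter_subset _ _)).trans_eq
        (Finset.sum_congr rfl fun w hw => hUU w (hS hw))
    refine SD3.of_save_star u T₁ (by simp [hT₁]) H f' ?_ ?_
    · intro w hw
      rw [hT₁, mem_filter] at hw
      exact (hadj w).2 ⟨hw.2, hS hw.1⟩
    refine SD3.mono (f' := Function.update f' u 1) ?_ _ ?_
    · refine SD3.of_delete_star u T₂ (by simp [hT₂]) _ _ ?_ (by simp) ?_
      · intro w hw
        rw [hT₂, mem_filter] at hw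
        simp only [SimpleGraph.deleteEdges_adj, starEdges, Set.mem_ofPred_eq, not_exists, not_and]
        refine ⟨(hadj w).2 ⟨hw.2.1, hw.1⟩, fun x hx => ?_⟩
        rw [Sym2.congr_right]
        rintro rfl
        exact hw.2.2 (mem_filter.1 hx).1
      · rw [SimpleGraph.deleteEdges_deleteEdges]
        refine ih _ _ ?_ ?_ ?_
        · have hstar : ∀ w, s(u, w) ∈ starEdges u T₁ ∪ starEdges u T₂ ↔ w ∈ T₁ ∪ T₂ := by
            intro w
            simp only [starEdges, Set.mem_union, Set.mem_ofPred_eq, Sym2.congr_right, mem_union,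
              exists_eq_right']
          intro v w
          rw [SimpleGraph.deleteEdges_adj]
          by_cases hv : v = u
          · subst hv
            rw [hstar, hadj]
            simp only [hu, false_and, and_false, iff_false, not_and, not_not]
            rintro ⟨h1, h2⟩
            by_cases hwS : w ∈ S <;> simp [hT₁, hT₂, hwS, h1, h2]
          by_cases hw : w = u
          · subst hw
            rw [Sym2.eq_swap, hstar, H.adj_comm, hadj]
            simp only [hu, and_false, iff_false, not_and, not_not]
            rintro ⟨h1, h2⟩
            by_cases hwS : v ∈ S <;> simp [hT₁, hT₂, hwS, h1, h2]
          · have hne : s(v, w) ∉ starEdges u T₁ ∪ starEdges u T₂ := by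
              rintro (⟨x, -, hx⟩ | ⟨x, -, hx⟩) <;>
              · rw [Sym2.eq_iff] at hx
                rcases hx with ⟨h1, -⟩ | ⟨-, h1⟩
                · exact hv h1
                · exact hw h1
            rw [hH]
            simp [hne, hv, hw]
        · intro v hv
          have hvu : v ≠ u := fun e => hu (e ▸ hv)
          simp [hT₂, hv, hvu, hUU v hv]
        · intro v hv
          by_cases hvu : v = u
          · subst hvu; simp [hT₂]
          · simpa [hT₂, hv, hvu] using hpos v (by simp [hv, hvu])
    · intro w
      by_cases hw : w = u
      · subst hw; simp; omega
      · simp [hw]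

theorem DelSave.sd3 [Fintype V] {f : V → ℕ} (h : DelSave G univ f) : SD3 G f :=
  h.sd3_aux G f (by simp) (by simp) (by simp)

/-! ### Deletion schemes give winning strategies for Painter -/

theorem DelSave.respond {U : Finset V} {f : V → ℕ} (h : DelSave G U f)
    (A : (V × ℕ) → (V × ℕ) → Prop) (hsymm : ∀ p q, A p q → A q p)
    (hadj : ∀ u a v b, A (u, a) (v, b) → u ≠ v → G.Adj u v)
    (hmatch : ∀ u v, u ≠ v → ∀ a b c, A (u, a) (v, b) → A (u, a) (v, c) → b = c) :
    ∀ L : V → Finset ℕ, (∀ v ∈ U, #(L v) ≤ f v) →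
      ∃ I : Finset (V × ℕ), (∀ p ∈ I, p.1 ∈ U ∧ p.2 ∈ L p.1) ∧
        (∀ p ∈ I, ∀ q ∈ I, p ≠ q → ¬ A p q) ∧
        DelSave G (U \ I.image Prod.fst) (fun v => f v - #(L v)) := by
  induction h with
  | empty f => exact fun L _ => ⟨∅, by simp, by simp, by simpa using DelSave.empty _⟩
  | @mono U f f' h hle ih =>
    intro L hL
    have : ∀ v, ∃ M ⊆ L v, #M = min #(L v) (f' v) := fun v =>
      Finset.exists_subset_card_eq (min_le_left _ _)
    choose M hM hMc using this
    obtain ⟨I, h1, h2, h3⟩ := ih M (fun v _ => by rw [hMc]; exact min_le_right _ _)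
    refine ⟨I, fun p hp => ⟨(h1 p hp).1, hM _ (h1 p hp).2⟩, h2, h3.mono fun v hv => ?_⟩
    have := hle v (mem_sdiff.1 hv).1
    rw [hMc]
    omega
  | @step U f u S hu hS hlt h ih =>
    intro L hL
    have hLU : ∀ v ∈ U, #(L v) ≤ f v := fun v hv => hL v (mem_insert_of_mem hv)
    have hLu : #(L u) ≤ f u := hL u (mem_insert_self _ _)
    by_cases hα : ∃ α ∈ L u, ∀ w ∈ S, ∀ β ∈ L w, ¬ A (u, α) (w, β)
    · obtain ⟨α, hαL, hα⟩ := hα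
      have : ∀ w, ∃ M ⊆ L w, #M = (if G.Adj u w ∧ w ∉ S then #(L w) - 1 else #(L w)) ∧
          (w ∈ U → ∀ β ∈ M, ¬ A (u, α) (w, β)) := by
        intro w
        split_ifs with hw
        · have hcard : #(L w) - 1 ≤ #((L w).filter fun β => ¬ A (u, α) (w, β)) := by
            have h1 := Finset.card_filter_add_card_filter_not (s := L w)
              (fun β => A (u, α) (w, β))
            have h2 : #((L w).filter fun β => A (u, α) (w, β)) ≤ 1 := by
              rw [Finset.card_le_one]
              intro b hb c hc
              exact hmatch u w hw.1.ne α b c (mem_filter.1 hb).2 (mem_filter.1 hc).2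
            omega
          obtain ⟨M, hM, hMc⟩ := Finset.exists_subset_card_eq hcard
          exact ⟨M, hM.trans (filter_subset _ _), hMc, fun _ β hβ => (mem_filter.1 (hM hβ)).2⟩
        · refine ⟨L w, Subset.rfl, rfl, fun hwU β hβ hA => hw ⟨?_, fun hwS => ?_⟩⟩
          · exact hadj _ _ _ _ hA fun e => hu (e ▸ hwU)
          · exact hα w hwS β hβ hA
      choose M hM hMc hMA using this
      obtain ⟨I, h1, h2, h3⟩ := ih M (fun v hv => by
        have := hLU v hv
        rw [hMc]; dsimp only; split_ifs <;> omega)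
      refine ⟨insert (u, α) I, ?_, ?_, ?_⟩
      · intro p hp
        rcases mem_insert.1 hp with rfl | hp
        · exact ⟨mem_insert_self _ _, hαL⟩
        · exact ⟨mem_insert_of_mem (h1 p hp).1, hM _ (h1 p hp).2⟩
      · intro p hp q hq hpq
        rcases mem_insert.1 hp with rfl | hp <;> rcases mem_insert.1 hq with rfl | hq
        · exact absurd rfl hpq
        · exact hMA q.1 (h1 q hq).1 q.2 (h1 q hq).2
        · exact fun hA => hMA p.1 (h1 p hp).1 p.2 (h1 p hp).2 (hsymm _ _ hA)
        · exact h2 p hp q hq hpq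
      · have hset : insert u U \ (insert (u, α) I).image Prod.fst = U \ I.image Prod.fst := by
          ext v
          simp only [image_insert, mem_sdiff, mem_insert, not_or]
          constructor
          · rintro ⟨h1, h2, h3⟩
            exact ⟨h1.resolve_left h2, h3⟩
          · rintro ⟨h1, h3⟩
            exact ⟨Or.inr h1, fun e => hu (e ▸ h1), h3⟩
        rw [hset]
        refine h3.mono fun v hv => ?_
        rw [hMc]
        dsimp only
        split_ifs <;> omega
    · push Not at hα
      have hcount : #(L u) ≤ ∑ w ∈ S, #(L w) := by
        rw [← Finset.card_sigma]
        have : Nonempty V := ⟨u⟩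
        choose! w hwS β hβ hA using hα
        refine Finset.card_le_card_of_injOn (fun α => ⟨w α, β α⟩) ?_ ?_
        · intro α hα
          simpa using ⟨hwS α hα, hβ α hα⟩
        · intro α hα α' hα' e
          simp only [Sigma.mk.injEq, heq_eq_eq] at e
          have h1 := hA α hα
          have h2 := hA α' hα'
          rw [← e.1, ← e.2] at h2
          exact hmatch (w α) u (fun e => hu (e ▸ hS (hwS α hα))) (β α) α α' (hsymm _ _ h1)
            (hsymm _ _ h2)
      have : ∀ v, ∃ M ⊆ L v,
          #M = min #(L v) (if G.Adj u v ∧ v ∉ S then f v - 1 else f v) := fun v =>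
        Finset.exists_subset_card_eq (min_le_left _ _)
      choose M hM hMc using this
      obtain ⟨I, h1, h2, h3⟩ := ih M (fun v _ => by rw [hMc]; exact min_le_right _ _)
      have huI : u ∉ I.image Prod.fst := by
        intro hI
        obtain ⟨p, hp, rfl⟩ := mem_image.1 hI
        exact hu (h1 p hp).1
      refine ⟨I, fun p hp => ⟨mem_insert_of_mem (h1 p hp).1, hM _ (h1 p hp).2⟩, h2, ?_⟩
      rw [Finset.insert_sdiff_of_notMem _ huI]
      refine DelSave.step u (S \ I.image Prod.fst) (fun hm => hu (mem_sdiff.1 hm).1)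
        (Finset.sdiff_subset_sdiff hS Subset.rfl) ?_ (h3.mono fun v hv => ?_)
      · have e1 : ∑ w ∈ S, (f w - #(L w)) + ∑ w ∈ S, #(L w) = ∑ w ∈ S, f w := by
          rw [← Finset.sum_add_distrib]
          exact Finset.sum_congr rfl fun w hw => Nat.sub_add_cancel (hLU w (hS hw))
        have e2 : ∑ w ∈ S \ I.image Prod.fst, (f w - #(L w)) ≤ ∑ w ∈ S, (f w - #(L w)) :=
          Finset.sum_le_sum_of_subset sdiff_subset
        omega
      · have hv' := (mem_sdiff.1 hv).2
        simp only [mem_sdiff, hv', not_false_eq_true, and_true]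
        rw [hMc]
        split_ifs <;> omega

theorem DelSave.dpPaintN [Fintype V] :
    ∀ (n : ℕ) (U : Finset V) (f : V → ℕ), DelSave G U f → ∑ v, f v ≤ n → DPPaintN G n U f := by
  intro n
  induction n with
  | zero =>
    intro U f h hs
    rw [DPPaintN, Finset.eq_empty_iff_forall_notMem]
    intro v hv
    have h1 := h.pos v hv
    have h2 := Finset.single_le_sum (f := f) (fun v _ => Nat.zero_le _) (mem_univ v)
    omega
  | succ n ih =>
    intro U f h hs
    rw [DPPaintN]
    refine Or.inr ⟨h.pos, fun g hg hg1 A hsymm hirr hlist hadj hclique hmatch => ?_⟩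
    obtain ⟨I, h1, h2, h3⟩ := h.respond A (fun _ _ => @hsymm _ _) hadj hmatch (fun v => range (g v))
      (fun v _ => by simpa using hg v)
    refine ⟨I, fun p hp => mem_range.1 (h1 p hp).2, ?_, ?_⟩
    · intro p hp q hq hA
      by_cases hpq : p = q
      · exact hirr p (by rw [← hpq] at hA; exact hA)
      · exact h2 p hp q hq hpq hA
    · refine ih _ _ (by simpa using h3) ?_
      obtain ⟨v, hv⟩ := hg1
      have : ∑ v, (f v - g v) < ∑ v, f v :=
        Finset.sum_lt_sum (fun w _ => Nat.sub_le _ _)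
          ⟨v, mem_univ v, by have := hg v; omega⟩
      omega

theorem DelSave.dpPaint [Fintype V] {f : V → ℕ} (h : DelSave G univ f) : DPPaint G univ f :=
  ⟨_, h.dpPaintN _ _ _ le_rfl⟩

/-! ### Combining deletion schemes -/

/-- The number of neighbours of `v` in `X`. -/
noncomputable def nbCount (G : SimpleGraph V) (v : V) (X : Finset V) : ℕ := #(X.filter (G.Adj v))

theorem nbCount_insert {v u : V} {X : Finset V} (hu : u ∉ X) :
    nbCount G v (insert u X) = nbCount G v X + if G.Adj v u then 1 else 0 := by
  unfold nbCount
  rw [filter_insert]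
  split_ifs
  · rw [card_insert_of_notMem (by simp [hu])]
  · simp

theorem nbCount_union {v : V} {X Y : Finset V} (h : Disjoint X Y) :
    nbCount G v (X ∪ Y) = nbCount G v X + nbCount G v Y := by
  unfold nbCount
  rw [filter_union, card_union_of_disjoint (disjoint_filter_filter h)]

theorem nbCount_mono {v : V} {X Y : Finset V} (h : X ⊆ Y) : nbCount G v X ≤ nbCount G v Y :=
  card_le_card (filter_subset_filter _ h)

theorem nbCount_sdiff_add {v : V} {X Y : Finset V} (h : Y ⊆ X) :
    nbCount G v (X \ Y) + nbCount G v Y = nbCount G v X := by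
  rw [← nbCount_union sdiff_disjoint, sdiff_union_of_subset h]

theorem nbCount_eq_zero {v : V} {X : Finset V} (h : ∀ w ∈ X, ¬ G.Adj v w) :
    nbCount G v X = 0 := by
  simpa [nbCount, filter_eq_empty_iff] using h

theorem DelSave.union {U : Finset V} {f : V → ℕ} (h : DelSave G U f) {W : Finset V} :
    ∀ g : V → ℕ, Disjoint U W → (∀ v ∈ U, g v = f v) →
      DelSave G W (fun w => g w - nbCount G w U) → DelSave G (U ∪ W) g := by
  induction h with
  | empty f =>
    intro g _ _ hW
    simpa [nbCount] using hW
  | @mono U f f' h hle ih =>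
    intro g hd hg hW
    refine DelSave.mono (ih (fun v => if v ∈ U then f' v else g v) hd (by simp +contextual)
      (hW.mono ?_)) ?_
    · intro w hw
      simp [Finset.disjoint_right.1 hd hw]
    · intro v _
      split_ifs with hv
      · exact (hle v hv).trans (hg v hv).ge
      · exact le_rfl
  | @step U f u S hu hS hlt h ih =>
    intro g hd hg hW
    rw [Finset.disjoint_insert_left] at hd
    rw [Finset.insert_union]
    refine DelSave.step u S (by simp [hu, hd.1]) (hS.trans subset_union_left) ?_
      (ih _ hd.2 ?_ (hW.mono ?_))
    · rw [hg u (mem_insert_self _ _), Finset.sum_congr rfl fun w hw =>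
        hg w (mem_insert_of_mem (hS hw))]
      exact hlt
    · intro v hv
      rw [hg v (mem_insert_of_mem hv)]
    · intro w hw
      have hwS : w ∉ S := fun hm => Finset.disjoint_right.1 hd.2 hw (hS hm)
      simp only [hwS, not_false_eq_true, and_true, nbCount_insert hu, G.adj_comm u w]
      split_ifs <;> omega

/-- Removing an independent set `X` first, where `u ∈ X` saves the vertices of `S u`. -/
theorem DelSave.union_of_save {X Y : Finset V} (S : V → Finset V) :
    ∀ g : V → ℕ, (∀ u ∈ X, ∀ v ∈ X, ¬ G.Adj u v) → Disjoint X Y → (∀ u ∈ X, S u ⊆ Y) →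
      (∀ u ∈ X, ∑ w ∈ S u, g w < g u) →
      DelSave G Y (fun w => g w - #(X.filter fun u => G.Adj u w ∧ w ∉ S u)) →
      DelSave G (X ∪ Y) g := by
  induction X using Finset.induction_on with
  | empty => intro g _ _ _ _ h; simpa using h
  | insert u X hu ih =>
    intro g hX hd hS hlt h
    rw [Finset.disjoint_insert_left] at hd
    have hle : ∀ w, (if G.Adj u w ∧ w ∉ S u then g w - 1 else g w) ≤ g w := by
      intro w; split_ifs <;> omega
    rw [Finset.insert_union]
    refine DelSave.step u (S u) (by simp [hu, hd.1])
      ((hS u (mem_insert_self _ _)).trans subset_union_right) (hlt u (mem_insert_self _ _))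
      (ih _ ?_ hd.2 ?_ ?_ (h.mono ?_))
    · exact fun a ha b hb => hX a (mem_insert_of_mem ha) b (mem_insert_of_mem hb)
    · exact fun a ha => hS a (mem_insert_of_mem ha)
    · intro a ha
      have hna := hX u (mem_insert_self _ _) a (mem_insert_of_mem ha)
      simp only [hna, false_and, if_false]
      exact (Finset.sum_le_sum fun w _ => hle w).trans_lt (hlt a (mem_insert_of_mem ha))
    · intro w _
      rw [filter_insert]
      split_ifs
      · rw [card_insert_of_notMem (by simp [hu])]; omega
      · exact le_rfl

theorem DelSave.of_indep {X : Finset V} {f : V → ℕ} (hX : ∀ u ∈ X, ∀ v ∈ X, ¬ G.Adj u v)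
    (hf : ∀ v ∈ X, 1 ≤ f v) : DelSave G X f := by
  simpa using DelSave.union_of_save (Y := ∅) (fun _ => ∅) f hX (by simp) (by simp)
    (by simpa [Nat.pos_iff_ne_zero, Nat.one_le_iff_ne_zero] using hf) (DelSave.empty _)

theorem DelSave.indep_union {X Y : Finset V} {f : V → ℕ} (hX : ∀ u ∈ X, ∀ v ∈ X, ¬ G.Adj u v)
    (hf : ∀ v ∈ X, 1 ≤ f v) (hd : Disjoint X Y)
    (h : DelSave G Y (fun w => f w - nbCount G w X)) : DelSave G (X ∪ Y) f :=
  (DelSave.of_indep hX hf).union f hd (fun _ _ => rfl) h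

/-! ### Distributing saves with the Hall marriage theorem -/

theorem exists_labelling_of_mul_le {α : Type*} (t : ℕ) : ∀ (q : ℕ) (s : Finset α), q * t ≤ #s →
    ∃ g : α → ℕ, ∀ j < q, t ≤ #(s.filter fun x => g x = j) := by
  intro q
  induction q with
  | zero => exact fun s _ => ⟨fun _ => 0, by simp⟩
  | succ q ih =>
    intro s hs
    rw [Nat.succ_mul] at hs
    obtain ⟨T, hT, hTc⟩ := Finset.exists_subset_card_eq (s := s) (n := t) (by omega)
    obtain ⟨g, hg⟩ := ih (s \ T) (by rw [card_sdiff_of_subset hT]; omega)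
    refine ⟨fun x => if x ∈ T then q else g x, fun j hj => ?_⟩
    rcases Nat.lt_succ_iff_lt_or_eq.1 hj with hj | rfl
    · refine (hg j hj).trans (card_le_card fun x hx => ?_)
      simp only [mem_filter, mem_sdiff] at hx ⊢
      simp [hx.1.1, hx.1.2, hx.2]
    · rw [← hTc]
      exact card_le_card fun x hx => by simp [hT hx, hx]

theorem exists_saves {X Y : Finset V} {D q k t : ℕ} (hkt : 0 < k * t) (hD : D ≤ k * t)
    (hX : ∀ u ∈ X, nbCount G u Y ≤ D) (hY : ∀ w ∈ Y, q * t ≤ nbCount G w X) :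
    ∃ S : V → Finset V, (∀ u ∈ X, S u ⊆ Y ∧ #(S u) ≤ k) ∧
      ∀ w ∈ Y, q ≤ #(X.filter fun u => G.Adj u w ∧ w ∈ S u) := by
  have hlab : ∀ w, ∃ g : V → ℕ, w ∈ Y →
      ∀ j < q, t ≤ #((X.filter (G.Adj w)).filter fun x => g x = j) := by
    intro w
    by_cases hw : w ∈ Y
    · obtain ⟨g, hg⟩ := exists_labelling_of_mul_le t q _ (hY w hw)
      exact ⟨g, fun _ => hg⟩
    · exact ⟨fun _ => 0, fun h => absurd h hw⟩
  choose g hg using hlab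
  let blk : Y × Fin q → Finset (V × ℕ) := fun i =>
    ((X.filter (G.Adj i.1)).filter fun x => g i.1 x = i.2) ×ˢ range k
  have hall : ∀ s : Finset (Y × Fin q), #s ≤ #(s.biUnion blk) := by
    intro s
    have := Finset.card_mul_le_card_mul (s := s) (t := s.biUnion blk)
      (fun i p => p ∈ blk i) (m := k * t) (n := k * t) ?_ ?_
    · exact Nat.le_of_mul_le_mul_right this hkt
    · intro i hi
      have h1 : (s.biUnion blk).bipartiteAbove (fun i p => p ∈ blk i) i = blk i := by
        ext p
        simp only [bipartiteAbove, mem_filter, mem_biUnion, and_iff_right_iff_imp]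
        exact fun hp => ⟨i, hi, hp⟩
      rw [h1, card_product, card_range, mul_comm]
      exact Nat.mul_le_mul_right _ (hg i.1 i.1.2 i.2 i.2.2)
    · intro p hp
      obtain ⟨i, -, hi⟩ := mem_biUnion.1 hp
      simp only [blk, mem_product, mem_filter] at hi
      refine le_trans ?_ ((hX p.1 hi.1.1.1).trans hD)
      refine Finset.card_le_card_of_injOn (fun i => (i.1 : V)) ?_ ?_
      · intro i hi
        simp only [bipartiteBelow, blk, mem_product, mem_filter, coe_filter,
          Set.mem_ofPred_eq] at hi ⊢
        exact ⟨i.1.2, hi.2.1.1.2.symm⟩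
      · intro i hi j hj e
        simp only [bipartiteBelow, blk, mem_product, mem_filter, coe_filter,
          Set.mem_ofPred_eq] at hi hj
        have e' : i.1 = j.1 := Subtype.ext e
        refine Prod.ext e' (Fin.ext ?_)
        rw [← hi.2.1.2, ← hj.2.1.2, e']
  obtain ⟨F, hFinj, hF⟩ := (Finset.all_card_le_biUnion_card_iff_exists_injective blk).1 hall
  simp only [blk, mem_product, mem_filter, mem_range] at hF
  refine ⟨fun u => (univ.filter fun i => (F i).1 = u).image fun i => (i.1 : V), ?_, ?_⟩
  · intro u _
    refine ⟨?_, card_image_le.trans ?_⟩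
    · intro w hw
      obtain ⟨i, -, rfl⟩ := mem_image.1 hw
      exact i.1.2
    · refine (Finset.card_le_card_of_injOn (fun i => (F i).2) (t := range k) ?_ ?_).trans_eq
        (card_range k)
      · intro i _
        simpa using (hF i).2
      · intro i hi j hj e
        simp only [mem_univ, true_and, coe_filter, Set.mem_ofPred_eq] at hi hj
        exact hFinj (Prod.ext (hi.trans hj.symm) e)
  · intro w hw
    refine (Finset.card_fin q).symm.trans_le
      (Finset.card_le_card_of_injOn (fun j => (F (⟨w, hw⟩, j)).1) ?_ ?_)
    · intro j _
      have := hF (⟨w, hw⟩, j)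
      simp only [coe_filter, Set.mem_ofPred_eq]
      refine ⟨this.1.1.1, this.1.1.2.symm, mem_image.2 ⟨(⟨w, hw⟩, j), by simp, rfl⟩⟩
    · intro j _ j' _ e
      have h1 := (hF (⟨w, hw⟩, j)).1.2
      have h2 := (hF (⟨w, hw⟩, j')).1.2
      dsimp only at e h1 h2
      rw [e] at h1
      exact Fin.ext (h1.symm.trans h2)

/-! ### Bipartite graphs with a layered side -/

theorem mul_block_size_le {d K L a e i m : ℕ} (he : 32 * K ≤ 2 ^ e) (hL : a + e ≤ L)
    (hd : 4 ^ L ≤ d) (hai : a ≤ i) (hiL : i < L) (hm : d ≤ m * (4 * K * 2 ^ (i + 1))) :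
    2 ^ (L - (a + e)) * (3 * d / (2 ^ L * 2 ^ (i - a)) + 1) ≤ m := by
  set T := 3 * d / (2 ^ L * 2 ^ (i - a)) with hT
  have h1 : T * (2 ^ L * 2 ^ (i - a)) ≤ 3 * d := Nat.div_mul_le_self _ _
  have h2 : 2 ^ L * 2 ^ (i - a) ≤ d := by
    refine le_trans ?_ hd
    rw [← pow_add, show (4 : ℕ) = 2 ^ 2 by norm_num, ← pow_mul]
    exact Nat.pow_le_pow_right (by norm_num) (by omega)
  have h3 : (T + 1) * (2 ^ L * 2 ^ (i - a)) ≤ 4 * d := by rw [add_mul]; omega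
  have h4 : 2 ^ L * 2 ^ (i - a) = 2 ^ (L - (a + e)) * 2 ^ e * 2 ^ i := by
    rw [← pow_add, ← pow_add, ← pow_add]
    congr 1
    omega
  rw [h4] at h3
  have hpos : 0 < 2 ^ e * 2 ^ i := by positivity
  refine Nat.le_of_mul_le_mul_right ?_ hpos
  calc 2 ^ (L - (a + e)) * (T + 1) * (2 ^ e * 2 ^ i)
      = (T + 1) * (2 ^ (L - (a + e)) * 2 ^ e * 2 ^ i) := by ring
    _ ≤ 4 * d := h3
    _ ≤ 4 * (m * (4 * K * 2 ^ (i + 1))) := by gcongr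
    _ = m * (32 * K * 2 ^ i) := by ring
    _ ≤ m * (2 ^ e * 2 ^ i) := by gcongr

/-- The independent sets `A \ R 0`, ..., `B \ SB`, `R L`, `SB` are removed in this order. The
vertices of `SB` start with too small a value, and are saved by the layers `R i \ R (i + 1)`. -/
theorem DelSave.of_layers {A B SB : Finset V} {R : ℕ → Finset V} {L a e d K s : ℕ}
    (hAB : Disjoint A B) (hA : ∀ u ∈ A, ∀ v ∈ A, ¬ G.Adj u v)
    (hB : ∀ u ∈ B, ∀ v ∈ B, ¬ G.Adj u v) (hSB : SB ⊆ B) (hRA : ∀ i, R i ⊆ A)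
    (hR : ∀ i, R (i + 1) ⊆ R i)
    (hAup : ∀ u ∈ A, nbCount G u SB * 2 ^ L ≤ 3 * d) (hAlo : ∀ u ∈ A, s + 1 ≤ nbCount G u SB)
    (hBup : ∀ w ∈ B, ∀ i ≤ L, nbCount G w (R i) * 2 ^ i ≤ 3 * d)
    (hBlo : ∀ w ∈ B, s + 1 ≤ nbCount G w (R L))
    (hBlay : ∀ w ∈ B, ∀ i < L, d ≤ nbCount G w (R i \ R (i + 1)) * (4 * K * 2 ^ (i + 1)))
    (hdeg : ∀ u ∈ A, d ≤ K * nbCount G u B) (hs : 2 * K * s ≤ d) (ha : 6 * K < 2 ^ a)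
    (he : 32 * K ≤ 2 ^ e) (hL : a + e ≤ L) (hd : 4 ^ L ≤ d)
    (hsq : s + 1 = 2 ^ (L - (a + e)) * (L - a)) :
    DelSave G (A ∪ B) (fun v => nbCount G v (A ∪ B) - s) := by
  set q := 2 ^ (L - (a + e)) with hq
  set H : ℕ → V → ℕ := fun i v => if v ∈ A then nbCount G v B - s else
    if v ∈ SB then nbCount G v (R i) + q * (i - a) - s else nbCount G v (R i) - s with hH
  have hHA : ∀ i, ∀ v ∈ A, H i v = nbCount G v B - s := fun i v hv => by simp [hH, hv]
  have hHS : ∀ i, ∀ v ∈ SB, H i v = nbCount G v (R i) + q * (i - a) - s := fun i v hv => by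
    simp [hH, hv, Finset.disjoint_right.1 hAB (hSB hv)]
  have hHB : ∀ i, ∀ v ∈ B, v ∉ SB → H i v = nbCount G v (R i) - s := fun i v hv hv' => by
    simp [hH, hv', Finset.disjoint_right.1 hAB hv]
  have hRmono : ∀ i j, i ≤ j → R j ⊆ R i := fun i j h => antitone_nat_of_succ_le hR h
  have hRind : ∀ i, ∀ u ∈ R i, ∀ v ∈ R i, ¬ G.Adj u v := fun i u hu v hv =>
    hA u (hRA i hu) v (hRA i hv)
  have hRB : ∀ i, Disjoint (R i) B := fun i => Finset.disjoint_of_subset_left (hRA i) hAB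
  have hApos : ∀ u ∈ A, 1 ≤ nbCount G u B - s := fun u hu => by
    have := (hAlo u hu).trans (nbCount_mono hSB)
    omega
  have hlast : DelSave G (R L ∪ B) (H L) := by
    have hset : R L ∪ B = (B \ SB) ∪ (R L ∪ SB) := by
      rw [union_left_comm, sdiff_union_of_subset hSB]
    rw [hset]
    refine DelSave.indep_union ?_ ?_ ?_ (DelSave.indep_union (hRind L) ?_ ?_
      (DelSave.of_indep ?_ ?_))
    · exact fun u hu v hv => hB u (sdiff_subset hu) v (sdiff_subset hv)
    · intro v hv
      rw [mem_sdiff] at hv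
      have := hBlo v hv.1
      rw [hHB L v hv.1 hv.2]
      omega
    · rw [disjoint_union_right]
      exact ⟨Finset.disjoint_of_subset_left sdiff_subset (hRB L).symm, sdiff_disjoint⟩
    · intro u hu
      rw [hHA L u (hRA L hu)]
      have h1 := nbCount_sdiff_add (G := G) (v := u) hSB
      have h2 := hAlo u (hRA L hu)
      omega
    · exact Finset.disjoint_of_subset_right hSB (hRB L)
    · exact fun u hu v hv => hB u (hSB hu) v (hSB hv)
    · intro w hw
      have h0 : nbCount G w (B \ SB) = 0 :=
        nbCount_eq_zero fun v hv => hB w (hSB hw) v (sdiff_subset hv)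
      rw [hHS L w hw, h0, ← hsq]
      omega
  have hstep : ∀ i, a ≤ i → i < L → DelSave G (R (i + 1) ∪ B) (H (i + 1)) →
      DelSave G (R i ∪ B) (H i) := by
    intro i hai hiL hnext
    have hXA : R i \ R (i + 1) ⊆ A := sdiff_subset.trans (hRA i)
    have hset : R i ∪ B = (R i \ R (i + 1)) ∪ (R (i + 1) ∪ B) := by
      rw [← union_assoc, sdiff_union_of_subset (hR i)]
    set t := 3 * d / (2 ^ L * 2 ^ (i - a)) + 1 with ht
    have hD : 3 * d / 2 ^ L ≤ 2 ^ (i - a) * t := by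
      have := Nat.lt_mul_div_succ (3 * d) (b := 2 ^ L * 2 ^ (i - a)) (by positivity)
      have h2 : 2 ^ L * (3 * d / 2 ^ L) ≤ 3 * d := Nat.mul_div_le _ _
      refine Nat.le_of_mul_le_mul_left (c := 2 ^ L) ?_ (by positivity)
      rw [← mul_assoc]
      exact h2.trans this.le
    obtain ⟨S, hS, hSq⟩ := exists_saves (G := G) (X := R i \ R (i + 1)) (Y := SB)
      (D := 3 * d / 2 ^ L) (q := q) (k := 2 ^ (i - a)) (t := t)
      (Nat.mul_pos (by positivity) (Nat.succ_pos _)) hD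
      (fun u hu => (Nat.le_div_iff_mul_le (by positivity)).2 (hAup u (hXA hu)))
      (fun w hw => mul_block_size_le he hL hd hai hiL (hBlay w (hSB hw) i hiL))
    rw [hset]
    refine DelSave.union_of_save S (H i) ?_ ?_ ?_ ?_ (hnext.mono ?_)
    · exact fun u hu v hv => hA u (hXA hu) v (hXA hv)
    · rw [disjoint_union_right]
      exact ⟨sdiff_disjoint, Finset.disjoint_of_subset_left hXA hAB⟩
    · exact fun u hu => (hS u hu).1.trans (hSB.trans subset_union_right)
    · intro u hu
      have huA := hXA hu
      rw [hHA i u huA]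
      have hqs : q * (i - a) ≤ s := by
        have h1 : q * (i - a) + q ≤ q * (L - a) := by
          rw [← Nat.mul_succ]
          exact Nat.mul_le_mul_left _ (by omega)
        have h2 : 0 < q := Nat.two_pow_pos _
        omega
      have h1 : ∀ w ∈ S u, H i w * 2 ^ i ≤ 3 * d := by
        intro w hw
        have hwS := (hS u hu).1 hw
        rw [hHS i w hwS]
        exact (Nat.mul_le_mul_right _ (by omega)).trans (hBup w (hSB hwS) i hiL.le)
      have h2 : (∑ w ∈ S u, H i w) * 2 ^ i ≤ 2 ^ (i - a) * (3 * d) := by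
        rw [Finset.sum_mul]
        refine (Finset.sum_le_card_nsmul _ _ _ h1).trans ?_
        rw [smul_eq_mul]
        exact Nat.mul_le_mul_right _ (hS u hu).2
      have h3 : (∑ w ∈ S u, H i w) * 2 ^ a ≤ 3 * d := by
        refine Nat.le_of_mul_le_mul_left (c := 2 ^ (i - a)) ?_ (by positivity)
        refine le_trans (le_of_eq ?_) h2
        rw [show 2 ^ i = 2 ^ (i - a) * 2 ^ a by rw [← pow_add]; congr 1; omega]
        ring
      have h4 : d ≤ 2 * K * (nbCount G u B - s) := by
        have h5 := hdeg u huA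
        rw [Nat.mul_sub]
        have h6 : 2 * K * nbCount G u B = 2 * (K * nbCount G u B) := by ring
        omega
      have h5 := hApos u huA
      refine Nat.lt_of_mul_lt_mul_right (a := 2 ^ a) ?_
      calc (∑ w ∈ S u, H i w) * 2 ^ a ≤ 3 * d := h3
        _ ≤ 3 * (2 * K * (nbCount G u B - s)) := by gcongr
        _ = (nbCount G u B - s) * (6 * K) := by ring
        _ < (nbCount G u B - s) * 2 ^ a := Nat.mul_lt_mul_of_pos_left ha h5
    · intro w hw
      have hle : #((R i \ R (i + 1)).filter fun u => G.Adj u w ∧ w ∉ S u) ≤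
          nbCount G w (R i \ R (i + 1)) := by
        refine card_le_card fun u hu => ?_
        rw [mem_filter] at hu ⊢
        exact ⟨hu.1, hu.2.1.symm⟩
      have hadd := nbCount_sdiff_add (G := G) (v := w) (hR i)
      rcases mem_union.1 hw with hwR | hwB
      · have hwA := hRA _ hwR
        have h0 : nbCount G w (R i \ R (i + 1)) = 0 :=
          nbCount_eq_zero fun v hv => hA w hwA v (hXA hv)
        rw [hHA _ w hwA, hHA _ w hwA]
        omega
      by_cases hwS : w ∈ SB
      · have hsplit : #((R i \ R (i + 1)).filter fun u => G.Adj u w ∧ w ∉ S u) +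
            #((R i \ R (i + 1)).filter fun u => G.Adj u w ∧ w ∈ S u) ≤
            nbCount G w (R i \ R (i + 1)) := by
          rw [← card_union_of_disjoint]
          · refine card_le_card fun u hu => ?_
            simp only [mem_union, mem_filter] at hu ⊢
            rcases hu with hu | hu <;> exact ⟨hu.1, hu.2.1.symm⟩
          · rw [disjoint_filter]
            exact fun u _ h1 h2 => h1.2 h2.2
        have hq' := hSq w hwS
        have hlo := (hBlo w hwB).trans (nbCount_mono (hRmono (i + 1) L hiL))
        rw [hHS _ w hwS, hHS _ w hwS, show i + 1 - a = (i - a) + 1 by omega, Nat.mul_succ]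
        omega
      · rw [hHB _ w hwB hwS, hHB _ w hwB hwS]
        omega
  have hall : ∀ n ≤ L - a, DelSave G (R (L - n) ∪ B) (H (L - n)) := by
    intro n
    induction n with
    | zero => exact fun _ => hlast
    | succ n ih =>
      intro hn
      refine hstep _ (by omega) (by omega) ?_
      rw [show L - (n + 1) + 1 = L - n by omega]
      exact ih (by omega)
  have hfirst := hall (L - a) le_rfl
  rw [show L - (L - a) = a by omega] at hfirst
  have hset : A ∪ B = (A \ R a) ∪ (R a ∪ B) := by
    rw [← union_assoc, sdiff_union_of_subset (hRA a)]
  have hnA : ∀ u ∈ A, nbCount G u (A ∪ B) = nbCount G u B := fun u hu => by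
    rw [nbCount_union hAB, nbCount_eq_zero (hA u hu), zero_add]
  have hnB : ∀ u ∈ B, nbCount G u (A ∪ B) = nbCount G u A := fun u hu => by
    rw [nbCount_union hAB, nbCount_eq_zero (hB u hu), add_zero]
  have key : DelSave G ((A \ R a) ∪ (R a ∪ B)) (fun v => nbCount G v (A ∪ B) - s) := by
    refine DelSave.indep_union ?_ ?_ ?_ (hfirst.mono ?_)
    · exact fun u hu v hv => hA u (sdiff_subset hu) v (sdiff_subset hv)
    · intro u hu
      rw [hnA u (sdiff_subset hu)]
      exact hApos u (sdiff_subset hu)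
    · rw [disjoint_union_right]
      exact ⟨sdiff_disjoint, Finset.disjoint_of_subset_left sdiff_subset hAB⟩
    · intro w hw
      have hadd := nbCount_sdiff_add (G := G) (v := w) (hRA a)
      rcases mem_union.1 hw with hwR | hwB
      · have hwA := hRA _ hwR
        rw [hHA _ w hwA, hnA w hwA, nbCount_eq_zero fun v hv => hA w hwA v (sdiff_subset hv)]
        omega
      · rw [hnB w hwB]
        by_cases hwS : w ∈ SB
        · rw [hHS _ w hwS, Nat.sub_self, mul_zero]
          omega
        · rw [hHB _ w hwB hwS]
          omega
  rwa [← hset] at key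

/-! ### Dense induced bipartite subgraphs -/

theorem sum_nbCount_le_of_sparse {M D : ℕ} : ∀ (n : ℕ) (A B : Finset V), #A + #B = n →
    (∀ A' ⊆ A, ∀ B' ⊆ B, (A' ∪ B').Nonempty →
      (∃ v ∈ A', M * nbCount G v B' < D) ∨ ∃ v ∈ B', M * nbCount G v A' < D) →
    M * ∑ v ∈ A, nbCount G v B ≤ D * (#A + #B) := by
  intro n
  induction n with
  | zero =>
    intro A B hn _
    have : A = ∅ := Finset.card_eq_zero.1 (by omega)
    simp [this]
  | succ n ih =>
    intro A B hn h
    have hne : (A ∪ B).Nonempty := by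
      rw [Finset.nonempty_iff_ne_empty]
      intro h0
      rw [union_eq_empty] at h0
      simp [h0.1, h0.2] at hn
    rcases h A Subset.rfl B Subset.rfl hne with ⟨v, hv, hlt⟩ | ⟨v, hv, hlt⟩
    · have hc := card_erase_add_one hv
      have := ih (A.erase v) B (by omega)
        (fun A' hA' B' hB' => h A' (hA'.trans (erase_subset _ _)) B' hB')
      rw [← Finset.add_sum_erase A _ hv, mul_add]
      have e : D * (#A + #B) = D * (#(A.erase v) + #B) + D := by rw [← hc]; ring
      omega
    · have hc := card_erase_add_one hv
      have := ih A (B.erase v) (by omega)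
        (fun A' hA' B' hB' => h A' hA' B' (hB'.trans (erase_subset _ _)))
      have hsum : ∑ u ∈ A, nbCount G u B = ∑ u ∈ A, nbCount G u (B.erase v) + nbCount G v A := by
        have h1 : nbCount G v A = ∑ u ∈ A, if G.Adj u v then 1 else 0 := by
          rw [nbCount, card_filter]
          simp only [G.adj_comm v]
        rw [h1, ← Finset.sum_add_distrib]
        refine Finset.sum_congr rfl fun u _ => ?_
        rw [← nbCount_insert (notMem_erase v B), insert_erase hv]
      rw [hsum, mul_add]
      have e : D * (#A + #B) = D * (#A + #(B.erase v)) + D := by rw [← hc]; ring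
      omega

theorem exists_dense_bipartite {r D : ℕ} (C : G.Coloring (Fin r)) {U : Finset V}
    (hU : U.Nonempty) (hD : 0 < D) (hdeg : ∀ v ∈ U, D ≤ nbCount G v U) :
    ∃ A B : Finset V, A ⊆ U ∧ B ⊆ U ∧ (A ∪ B).Nonempty ∧ Disjoint A B ∧
      (∀ u ∈ A, ∀ v ∈ A, ¬ G.Adj u v) ∧ (∀ u ∈ B, ∀ v ∈ B, ¬ G.Adj u v) ∧
      (∀ v ∈ A, D ≤ 4 * r * nbCount G v B) ∧ (∀ v ∈ B, D ≤ 4 * r * nbCount G v A) := by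
  by_contra hcon
  set P : Fin r → Finset V := fun i => U.filter fun v => C v = i with hP
  have hind : ∀ i, ∀ u ∈ P i, ∀ v ∈ P i, ¬ G.Adj u v := by
    intro i u hu v hv hadj
    simp only [hP, mem_filter] at hu hv
    exact C.valid hadj (hu.2.trans hv.2.symm)
  have hpair : ∀ i j, 4 * r * ∑ v ∈ P i, nbCount G v (P j) ≤ D * (#(P i) + #(P j)) := by
    intro i j
    by_cases hij : i = j
    · subst hij
      rw [Finset.sum_eq_zero fun v hv => nbCount_eq_zero (hind i v hv)]
      simp
    · refine sum_nbCount_le_of_sparse _ _ _ rfl fun A hA B hB hne => ?_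
      by_contra hno
      push Not at hno
      refine hcon ⟨A, B, hA.trans (filter_subset _ _), hB.trans (filter_subset _ _), hne, ?_,
        fun u hu v hv => hind i u (hA hu) v (hA hv), fun u hu v hv => hind j u (hB hu) v (hB hv),
        hno.1, hno.2⟩
      rw [Finset.disjoint_left]
      intro v hv hv'
      have h1 := hA hv
      have h2 := hB hv'
      simp only [hP, mem_filter] at h1 h2
      exact hij (h1.2.symm.trans h2.2)
  have hcard : ∑ i, #(P i) = #U :=
    (Finset.card_eq_sum_card_fiberwise (f := C) (t := univ) (by simp)).symm
  have hnb : ∀ v, ∑ j, nbCount G v (P j) = nbCount G v U := by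
    intro v
    unfold nbCount
    rw [Finset.card_eq_sum_card_fiberwise (f := C) (t := univ) (s := U.filter (G.Adj v)) (by simp)]
    refine Finset.sum_congr rfl fun j _ => ?_
    rw [hP, filter_filter, filter_filter]
    congr 1
    ext w
    simp [and_comm]
  have htotal : ∑ i, ∑ j, ∑ v ∈ P i, nbCount G v (P j) = ∑ v ∈ U, nbCount G v U := by
    rw [← Finset.sum_fiberwise_of_maps_to (s := U) (t := univ) (g := C) (by simp)]
    refine Finset.sum_congr rfl fun i _ => ?_
    rw [Finset.sum_comm]
    exact Finset.sum_congr rfl fun v _ => hnb v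
  have hlow : #U * D ≤ ∑ v ∈ U, nbCount G v U := by
    simpa using Finset.card_nsmul_le_sum U _ D hdeg
  have hup : 4 * r * ∑ v ∈ U, nbCount G v U ≤ D * (2 * r * #U) := by
    rw [← htotal, Finset.mul_sum]
    calc ∑ i, 4 * r * ∑ j, ∑ v ∈ P i, nbCount G v (P j)
        ≤ ∑ i, ∑ j, D * (#(P i) + #(P j)) := by
          refine Finset.sum_le_sum fun i _ => ?_
          rw [Finset.mul_sum]
          exact Finset.sum_le_sum fun j _ => hpair i j
      _ = D * (2 * r * #U) := by
          simp only [← Finset.mul_sum, Finset.sum_add_distrib, Finset.sum_const, hcard,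
            Finset.card_univ, Fintype.card_fin, smul_eq_mul]
          ring
  obtain ⟨v, hv⟩ := hU
  have hr : 0 < r := Fin.pos (C v)
  have hUpos : 0 < #U := Finset.card_pos.2 ⟨v, hv⟩
  have h1 : 4 * r * (#U * D) ≤ D * (2 * r * #U) := (Nat.mul_le_mul_left _ hlow).trans hup
  have h2 : 0 < r * #U * D := by positivity
  nlinarith

/-! ### The Lovász local lemma for finite counting spaces -/

/-- The outcomes that avoid all bad events indexed by `J`. -/
noncomputable def avoiding {Ω ι : Type*} [Fintype Ω] (bad : ι → Finset Ω) (J : Finset ι) :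
    Finset Ω :=
  univ.filter fun ω => ∀ j ∈ J, ω ∉ bad j

theorem card_bad_inter_avoiding_le {Ω ι : Type*} [Fintype Ω] [DecidableEq Ω] [Nonempty Ω]
    (bad : ι → Finset Ω) (Γ : ι → Finset ι) {p : ℝ} {D : ℕ}
    (hp : ∀ i, (#(bad i) : ℝ) ≤ p * Fintype.card Ω) (hΓ : ∀ i, #(Γ i) ≤ D) (hpD : 4 * p * D ≤ 1)
    (hind : ∀ i J, Disjoint J (Γ i) →
      #(bad i ∩ avoiding bad J) * Fintype.card Ω = #(bad i) * #(avoiding bad J)) :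
    ∀ (n : ℕ) (J : Finset ι), #J = n → ∀ i,
      (#(bad i ∩ avoiding bad J) : ℝ) ≤ 2 * p * #(avoiding bad J) := by
  have hΩ : (0 : ℝ) < Fintype.card Ω := by exact_mod_cast Fintype.card_pos
  intro n
  induction n using Nat.strong_induction_on with
  | _ n ih =>
    intro J hJ i
    have hp0 : 0 ≤ p := by
      have h1 : (0 : ℝ) ≤ p * Fintype.card Ω := (Nat.cast_nonneg _).trans (hp i)
      exact nonneg_of_mul_nonneg_left h1 hΩ
    set J₂ := J \ Γ i with hJ₂
    have hsub : avoiding bad J ⊆ avoiding bad J₂ := by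
      intro ω hω
      simp only [avoiding, mem_filter, mem_univ, true_and] at hω ⊢
      exact fun j hj => hω j (sdiff_subset hj)
    have hfar : (#(bad i ∩ avoiding bad J₂) : ℝ) ≤ p * #(avoiding bad J₂) := by
      have h1 : (#(bad i ∩ avoiding bad J₂) : ℝ) * Fintype.card Ω =
          #(bad i) * #(avoiding bad J₂) := by
        exact_mod_cast hind i J₂ sdiff_disjoint
      refine le_of_mul_le_mul_right ?_ hΩ
      rw [h1]
      calc (#(bad i) : ℝ) * #(avoiding bad J₂)
          ≤ p * Fintype.card Ω * #(avoiding bad J₂) := by gcongr; exact hp i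
        _ = _ := by ring
    have hnear : (#(bad i ∩ avoiding bad J) : ℝ) ≤ #(bad i ∩ avoiding bad J₂) := by
      exact_mod_cast card_le_card (inter_subset_inter_left hsub)
    by_cases hlt : #J₂ < n
    · have hcover : avoiding bad J₂ ⊆
          avoiding bad J ∪ (Γ i).biUnion fun j => bad j ∩ avoiding bad J₂ := by
        intro ω hω
        by_cases hωJ : ω ∈ avoiding bad J
        · exact mem_union_left _ hωJ
        · refine mem_union_right _ (mem_biUnion.2 ?_)
          have hω' := hω
          simp only [avoiding, mem_filter, mem_univ, true_and, not_forall, not_not] at hωJ hω'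
          obtain ⟨j, hjJ, hj⟩ := hωJ
          refine ⟨j, ?_, mem_inter.2 ⟨hj, hω⟩⟩
          by_contra hjΓ
          exact hω' j (mem_sdiff.2 ⟨hjJ, hjΓ⟩) hj
      have hcard : (#(avoiding bad J₂) : ℝ) ≤
          #(avoiding bad J) + ∑ j ∈ Γ i, (#(bad j ∩ avoiding bad J₂) : ℝ) := by
        exact_mod_cast (card_le_card hcover).trans
          ((card_union_le _ _).trans (Nat.add_le_add_left card_biUnion_le _))
      have hsum : ∑ j ∈ Γ i, (#(bad j ∩ avoiding bad J₂) : ℝ) ≤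
          D * (2 * p * #(avoiding bad J₂)) := by
        refine (Finset.sum_le_card_nsmul _ _ _ fun j _ => ih _ hlt J₂ rfl j).trans ?_
        rw [nsmul_eq_mul]
        gcongr
        exact_mod_cast hΓ i
      have hhalf : D * (2 * p * #(avoiding bad J₂)) ≤ (1 / 2 : ℝ) * #(avoiding bad J₂) := by
        have : (D : ℝ) * (2 * p) ≤ 1 / 2 := by linarith
        rw [← mul_assoc]
        gcongr
      have h2 : (#(avoiding bad J₂) : ℝ) ≤ 2 * #(avoiding bad J) := by linarith
      calc (#(bad i ∩ avoiding bad J) : ℝ) ≤ p * #(avoiding bad J₂) := hnear.trans hfar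
        _ ≤ p * (2 * #(avoiding bad J)) := by gcongr
        _ = _ := by ring
    · have hJJ : J₂ = J := Finset.eq_of_subset_of_card_le sdiff_subset (by omega)
      rw [hJJ] at hfar
      have : 0 ≤ p * (#(avoiding bad J) : ℝ) := by positivity
      linarith

theorem exists_avoiding_of_local {Ω ι : Type*} [Fintype Ω] [DecidableEq Ω] [Nonempty Ω]
    [Fintype ι] (bad : ι → Finset Ω) (Γ : ι → Finset ι) {p : ℝ} {D : ℕ}
    (hp : ∀ i, (#(bad i) : ℝ) ≤ p * Fintype.card Ω) (hΓ : ∀ i, #(Γ i) ≤ D) (hD : 1 ≤ D)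
    (hpD : 4 * p * D ≤ 1)
    (hind : ∀ i J, Disjoint J (Γ i) →
      #(bad i ∩ avoiding bad J) * Fintype.card Ω = #(bad i) * #(avoiding bad J)) :
    ∃ ω, ∀ i, ω ∉ bad i := by
  have key := card_bad_inter_avoiding_le bad Γ hp hΓ hpD hind
  have hpos : ∀ J : Finset ι, (0 : ℝ) < #(avoiding bad J) := by
    intro J
    induction J using Finset.induction_on with
    | empty => simp [avoiding, Fintype.card_pos]
    | insert i J hi ih =>
      have hset : avoiding bad (insert i J) = avoiding bad J \ bad i := by
        ext ω
        simp [avoiding, and_comm]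
      have hcard : (#(avoiding bad J) : ℝ) ≤
          #(avoiding bad (insert i J)) + #(bad i ∩ avoiding bad J) := by
        rw [hset, inter_comm]
        exact_mod_cast (card_sdiff_add_card_inter (avoiding bad J) (bad i)).ge
      have hp4 : 4 * p ≤ 1 := by
        by_cases hp0 : 0 ≤ p
        · have hD' : (1 : ℝ) ≤ D := by exact_mod_cast hD
          nlinarith
        · linarith
      have := key _ J rfl i
      nlinarith
  obtain ⟨ω, hω⟩ := Finset.card_pos.1 (Nat.cast_pos.1 (hpos univ))
  refine ⟨ω, fun i => ?_⟩
  simp only [avoiding, mem_filter, mem_univ, true_and] at hω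
  exact hω i trivial

theorem card_inter_mul_card_of_independent {α β : Type*} [Fintype α] [Fintype β]
    [DecidableEq β] (T : Finset α) (E F : Finset (α → β))
    (hE : ∀ x y : α → β, (∀ v ∈ T, x v = y v) → x ∈ E → y ∈ E)
    (hF : ∀ x y : α → β, (∀ v ∉ T, x v = y v) → x ∈ F → y ∈ F) :
    #(E ∩ F) * Fintype.card (α → β) = #E * #F := by
  rw [← Finset.card_univ, ← card_product, ← card_product]
  refine Finset.card_nbij' (fun z => (T.piecewise z.1 z.2, T.piecewise z.2 z.1))
    (fun z => (T.piecewise z.1 z.2, T.piecewise z.2 z.1)) ?_ ?_ ?_ ?_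
  · rintro ⟨x, y⟩ h
    simp only [coe_product, Set.mem_prod, mem_coe, mem_inter] at h ⊢
    exact ⟨hE x _ (fun v hv => by simp [hv]) h.1.1, hF x _ (fun v hv => by simp [hv]) h.1.2⟩
  · rintro ⟨x, y⟩ h
    simp only [coe_product, Set.mem_prod, mem_coe, mem_inter, mem_univ, and_true] at h ⊢
    exact ⟨hE x _ (fun v hv => by simp [hv]) h.1, hF y _ (fun v hv => by simp [hv]) h.2⟩
  · rintro ⟨x, y⟩ _
    ext v <;> by_cases hv : v ∈ T <;> simp [hv]
  · rintro ⟨x, y⟩ _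
    ext v <;> by_cases hv : v ∈ T <;> simp [hv]

/-! ### Tail bounds for uniformly random labellings -/

theorem sum_pow_card_filter {α β : Type*} [Fintype α] [Fintype β] [DecidableEq β] [Nonempty β]
    (N : Finset α) (T : Finset β) (θ : ℝ) :
    ∑ x : α → β, θ ^ #(N.filter fun v => x v ∈ T) =
      Fintype.card (α → β) * (1 + #T / Fintype.card β * (θ - 1)) ^ #N := by
  have hβ : (Fintype.card β : ℝ) ≠ 0 := by exact_mod_cast Fintype.card_ne_zero
  have h1 : ∀ x : α → β, θ ^ #(N.filter fun v => x v ∈ T) =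
      ∏ v, if v ∈ N ∧ x v ∈ T then θ else 1 := by
    intro x
    rw [← Finset.prod_const, Finset.prod_filter]
    simp only [ite_and]
    rw [Finset.prod_ite_mem, univ_inter]
  have h2 : ∀ v, ∑ c : β, (if v ∈ N ∧ c ∈ T then θ else 1) =
      Fintype.card β * (if v ∈ N then 1 + #T / Fintype.card β * (θ - 1) else 1) := by
    intro v
    by_cases hv : v ∈ N
    · simp only [hv, true_and, if_true]
      have : ∀ c : β, (if c ∈ T then θ else 1) = 1 + if c ∈ T then θ - 1 else 0 := by
        intro c; split_ifs <;> ring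
      simp only [this, Finset.sum_add_distrib, Finset.sum_ite_mem, univ_inter, Finset.sum_const,
        nsmul_eq_mul, Finset.card_univ]
      field_simp
    · simp [hv]
  simp only [h1]
  rw [← Fintype.piFinset_univ, ← Finset.prod_univ_sum (fun _ => univ)
    (fun v c => if v ∈ N ∧ c ∈ T then θ else 1)]
  simp only [h2]
  rw [Finset.prod_mul_distrib, Finset.prod_const, Finset.prod_ite_mem, univ_inter,
    Finset.prod_const, Fintype.card_fun, Finset.card_univ]
  push_cast
  rfl

theorem card_upper_tail_le {α β : Type*} [Fintype α] [Fintype β] [DecidableEq β] [Nonempty β]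
    {N : Finset α} {T : Finset β} {d m : ℕ} (hm : 0 < m) (hT : #T * m = Fintype.card β)
    (hN : #N ≤ d) :
    (#(univ.filter fun x : α → β => 3 * d < #(N.filter fun v => x v ∈ T) * m) : ℝ) ≤
      Real.exp (-(d / m)) * Fintype.card (α → β) := by
  have hβ : (0 : ℝ) < Fintype.card β := by exact_mod_cast Fintype.card_pos
  have hm' : (0 : ℝ) < m := by exact_mod_cast hm
  have hp : (#T : ℝ) / Fintype.card β = 1 / m := by
    rw [div_eq_div_iff hβ.ne' hm'.ne', ← hT]; push_cast; ring
  have hmgf := sum_pow_card_filter (α := α) N T (Real.exp 1)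
  rw [hp] at hmgf
  set bad := univ.filter fun x : α → β => 3 * d < #(N.filter fun v => x v ∈ T) * m with hbad
  have h1 : (#bad : ℝ) * Real.exp (3 * d / m) ≤
      ∑ x : α → β, Real.exp 1 ^ #(N.filter fun v => x v ∈ T) := by
    rw [← nsmul_eq_mul]
    refine (Finset.card_nsmul_le_sum bad _ _ fun x hx => ?_).trans
      (Finset.sum_le_sum_of_subset_of_nonneg (subset_univ _) fun x _ _ => by positivity)
    rw [hbad, mem_filter] at hx
    rw [← Real.exp_nat_mul, mul_one, Real.exp_le_exp, div_le_iff₀ hm']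
    exact_mod_cast hx.2.le
  have h2 : (1 + 1 / m * (Real.exp 1 - 1)) ^ #N ≤ Real.exp (2 * d / m) := by
    have he : Real.exp 1 - 1 ≤ 2 := by linarith [Real.exp_one_lt_d9]
    have he' : 0 ≤ Real.exp 1 - 1 := by linarith [Real.exp_one_gt_d9]
    have hb : 1 + 1 / m * (Real.exp 1 - 1) ≤ Real.exp (2 / m) := by
      refine le_trans ?_ (Real.add_one_le_exp _)
      have : 1 / (m : ℝ) * (Real.exp 1 - 1) ≤ 1 / m * 2 := by gcongr
      have e : 1 / (m : ℝ) * 2 = 2 / m := by ring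
      linarith
    calc (1 + 1 / m * (Real.exp 1 - 1)) ^ #N ≤ Real.exp (2 / m) ^ #N := by gcongr
      _ = Real.exp (#N * (2 / m)) := by rw [← Real.exp_nat_mul]
      _ ≤ Real.exp (d * (2 / m)) := by gcongr
      _ = _ := by congr 1; ring
  refine le_of_mul_le_mul_right ?_ (Real.exp_pos (3 * d / m : ℝ))
  calc (#bad : ℝ) * Real.exp (3 * d / m) ≤ _ := h1
    _ = Fintype.card (α → β) * (1 + 1 / m * (Real.exp 1 - 1)) ^ #N := hmgf
    _ ≤ Fintype.card (α → β) * Real.exp (2 * d / m) := by gcongr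
    _ = _ := by
      rw [mul_right_comm (Real.exp _), ← Real.exp_add, mul_comm]
      congr 2
      ring

theorem card_lower_tail_le {α β : Type*} [Fintype α] [Fintype β] [DecidableEq β] [Nonempty β]
    {N : Finset α} {T : Finset β} {d m K : ℕ} (hm : 0 < m) (hK : 0 < K)
    (hT : #T * m = Fintype.card β) (hN : d ≤ K * #N) :
    (#(univ.filter fun x : α → β => #(N.filter fun v => x v ∈ T) * (4 * K * m) < d) : ℝ) ≤
      Real.exp (-(d / (4 * K * m))) * Fintype.card (α → β) := by
  have hβ : (0 : ℝ) < Fintype.card β := by exact_mod_cast Fintype.card_pos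
  have hm' : (0 : ℝ) < m := by exact_mod_cast hm
  have hm1 : (1 : ℝ) ≤ m := by exact_mod_cast hm
  have hK' : (0 : ℝ) < K := by exact_mod_cast hK
  have hp : (#T : ℝ) / Fintype.card β = 1 / m := by
    rw [div_eq_div_iff hβ.ne' hm'.ne', ← hT]; push_cast; ring
  have hmgf := sum_pow_card_filter (α := α) N T (Real.exp (-1))
  rw [hp] at hmgf
  set bad := univ.filter fun x : α → β => #(N.filter fun v => x v ∈ T) * (4 * K * m) < d
    with hbad
  have h1 : (#bad : ℝ) * Real.exp (-(d / (4 * K * m))) ≤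
      ∑ x : α → β, Real.exp (-1) ^ #(N.filter fun v => x v ∈ T) := by
    rw [← nsmul_eq_mul]
    refine (Finset.card_nsmul_le_sum bad _ _ fun x hx => ?_).trans
      (Finset.sum_le_sum_of_subset_of_nonneg (subset_univ _) fun x _ _ => by positivity)
    rw [hbad, mem_filter] at hx
    rw [← Real.exp_nat_mul, Real.exp_le_exp, mul_neg_one, neg_le_neg_iff,
      le_div_iff₀ (by positivity)]
    exact_mod_cast hx.2.le
  have h2 : (1 + 1 / m * (Real.exp (-1) - 1)) ^ #N ≤ Real.exp (-(d / (2 * K * m))) := by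
    have he : Real.exp (-1) ≤ 1 / 2 := by linarith [Real.exp_neg_one_lt_d9]
    have hb : 1 + 1 / m * (Real.exp (-1) - 1) ≤ Real.exp (-(1 / (2 * m))) := by
      refine le_trans ?_ (Real.add_one_le_exp _)
      have h3 : 1 / (m : ℝ) * (Real.exp (-1) - 1) ≤ 1 / m * (-(1 / 2)) := by
        gcongr; linarith
      have e : 1 / (m : ℝ) * (-(1 / 2)) = -(1 / (2 * m)) := by field_simp
      linarith
    have hb0 : 0 ≤ 1 + 1 / m * (Real.exp (-1) - 1) := by
      have h3 : 1 / (m : ℝ) ≤ 1 := by rw [div_le_one hm']; exact hm1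
      have h4 : 0 ≤ 1 / (m : ℝ) * Real.exp (-1) := by positivity
      rw [mul_sub, mul_one]
      linarith
    calc (1 + 1 / m * (Real.exp (-1) - 1)) ^ #N ≤ Real.exp (-(1 / (2 * m))) ^ #N := by gcongr
      _ = Real.exp (#N * (-(1 / (2 * m)))) := by rw [← Real.exp_nat_mul]
      _ ≤ _ := by
        rw [Real.exp_le_exp, mul_neg, neg_le_neg_iff, div_le_iff₀ (by positivity)]
        have : (d : ℝ) ≤ K * #N := by exact_mod_cast hN
        refine this.trans (le_of_eq ?_)
        field_simp
  refine le_of_mul_le_mul_right ?_ (Real.exp_pos (-(d / (4 * K * m)) : ℝ))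
  calc (#bad : ℝ) * Real.exp (-(d / (4 * K * m))) ≤ _ := h1
    _ = Fintype.card (α → β) * (1 + 1 / m * (Real.exp (-1) - 1)) ^ #N := hmgf
    _ ≤ Fintype.card (α → β) * Real.exp (-(d / (2 * K * m))) := by gcongr
    _ = _ := by
      rw [mul_right_comm (Real.exp _), ← Real.exp_add, mul_comm]
      congr 2
      field_simp
      ring

/-! ### Balanced labellings -/

/-- The first `2 ^ (L - j)` of the `2 ^ L` labels. -/
noncomputable def lowLabels (L j : ℕ) : Finset (Fin (2 ^ L)) :=
  univ.filter fun c => c.val < 2 ^ (L - j)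

theorem lowLabels_succ_subset (L j : ℕ) : lowLabels L (j + 1) ⊆ lowLabels L j := by
  intro c hc
  simp only [lowLabels, mem_filter, mem_univ, true_and] at hc ⊢
  exact hc.trans_le (Nat.pow_le_pow_right two_pos (by omega))

theorem card_lowLabels {L j : ℕ} : #(lowLabels L j) = 2 ^ (L - j) := by
  rw [lowLabels, Fin.card_filter_val_lt]
  exact min_eq_right (Nat.pow_le_pow_right two_pos (by omega))

theorem card_lowLabels_mul {L j : ℕ} (hj : j ≤ L) :
    #(lowLabels L j) * 2 ^ j = Fintype.card (Fin (2 ^ L)) := by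
  rw [card_lowLabels, Fintype.card_fin, ← pow_add]
  congr 1
  omega

theorem card_lowLabels_sdiff_mul {L j : ℕ} (hj : j < L) :
    #(lowLabels L j \ lowLabels L (j + 1)) * 2 ^ (j + 1) = Fintype.card (Fin (2 ^ L)) := by
  rw [card_sdiff_of_subset (lowLabels_succ_subset L j), Nat.sub_mul, card_lowLabels_mul hj,
    pow_succ, ← mul_assoc, card_lowLabels_mul hj.le]
  omega

/-- The labelling `x` meets the neighbourhood `N` roughly as often as expected. -/
def BalancedLabelling {α : Type*} (L d K : ℕ) (N : Finset α) (x : α → Fin (2 ^ L)) : Prop :=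
  (∀ j ≤ L, #(N.filter fun v => x v ∈ lowLabels L j) * 2 ^ j ≤ 3 * d) ∧
  (∀ j < L, d ≤ #(N.filter fun v => x v ∈ lowLabels L j \ lowLabels L (j + 1)) *
    (4 * K * 2 ^ (j + 1))) ∧
  d ≤ #(N.filter fun v => x v ∈ lowLabels L L) * (4 * K * 2 ^ L)

theorem BalancedLabelling.congr {α : Type*} {L d K : ℕ} {N : Finset α} {x y : α → Fin (2 ^ L)}
    (h : BalancedLabelling L d K N x) (hxy : ∀ v ∈ N, x v = y v) : BalancedLabelling L d K N y := by
  have key : ∀ T : Finset (Fin (2 ^ L)),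
      (N.filter fun v => y v ∈ T) = N.filter fun v => x v ∈ T :=
    fun T => Finset.filter_congr fun v hv => by rw [hxy v hv]
  simpa only [BalancedLabelling, key] using h

theorem card_not_balanced_le {α : Type*} [Fintype α] {L d K : ℕ} {N : Finset α} (hK : 0 < K)
    (hN : #N ≤ d) (hN' : d ≤ K * #N) :
    (#(univ.filter fun x : α → Fin (2 ^ L) => ¬ BalancedLabelling L d K N x) : ℝ) ≤
      (2 * L + 2) * Real.exp (-(d / (4 * K * 2 ^ L))) * Fintype.card (α → Fin (2 ^ L)) := by
  set p : ℝ := Real.exp (-(d / (4 * K * 2 ^ L))) * Fintype.card (α → Fin (2 ^ L)) with hp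
  have hK' : (1 : ℝ) ≤ K := by exact_mod_cast hK
  have hmono : ∀ z : ℝ, 0 < z → z ≤ 4 * K * 2 ^ L →
      Real.exp (-(d / z)) * Fintype.card (α → Fin (2 ^ L)) ≤ p := by
    intro z hz hzle
    rw [hp]
    gcongr
  set up : ℕ → Finset (α → Fin (2 ^ L)) := fun j => univ.filter fun x =>
    3 * d < #(N.filter fun v => x v ∈ lowLabels L j) * 2 ^ j with hup
  set lay : ℕ → Finset (α → Fin (2 ^ L)) := fun j => univ.filter fun x =>
    #(N.filter fun v => x v ∈ lowLabels L j \ lowLabels L (j + 1)) * (4 * K * 2 ^ (j + 1)) < d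
    with hlay
  set bot : Finset (α → Fin (2 ^ L)) := univ.filter fun x =>
    #(N.filter fun v => x v ∈ lowLabels L L) * (4 * K * 2 ^ L) < d with hbot
  have hupc : ∀ j ∈ range (L + 1), (#(up j) : ℝ) ≤ p := by
    intro j hj
    have hj' : j ≤ L := by simpa [Nat.lt_succ_iff] using hj
    have := card_upper_tail_le (α := α) (m := 2 ^ j) (by positivity) (card_lowLabels_mul hj') hN
    refine this.trans ?_
    push_cast
    refine hmono _ (by positivity) ?_
    calc (2 : ℝ) ^ j ≤ 2 ^ L := pow_le_pow_right₀ one_le_two hj'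
      _ = 1 * 2 ^ L := (one_mul _).symm
      _ ≤ 4 * K * 2 ^ L := by gcongr; linarith
  have hlayc : ∀ j ∈ range L, (#(lay j) : ℝ) ≤ p := by
    intro j hj
    have hj' : j < L := by simpa using hj
    have := card_lower_tail_le (α := α) (m := 2 ^ (j + 1)) (by positivity) hK
      (card_lowLabels_sdiff_mul hj') hN'
    refine this.trans ?_
    push_cast
    refine hmono _ (by positivity) ?_
    gcongr
    · exact one_le_two
    · exact hj'
  have hbotc : (#bot : ℝ) ≤ p := by
    have := card_lower_tail_le (α := α) (m := 2 ^ L) (by positivity) hK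
      (card_lowLabels_mul le_rfl) hN'
    refine this.trans ?_
    push_cast
    exact hmono _ (by positivity) le_rfl
  have hcover : (univ.filter fun x : α → Fin (2 ^ L) => ¬ BalancedLabelling L d K N x) ⊆
      (range (L + 1)).biUnion up ∪ (range L).biUnion lay ∪ bot := by
    intro x hx
    by_contra hcon
    simp only [hup, hlay, hbot, mem_union, mem_biUnion, mem_range, mem_filter, mem_univ, true_and,
      not_or, not_exists, not_and, not_lt, Nat.lt_succ_iff] at hcon
    exact (mem_filter.1 hx).2 ⟨hcon.1.1, hcon.1.2, hcon.2⟩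
  have hcard : (#(univ.filter fun x : α → Fin (2 ^ L) => ¬ BalancedLabelling L d K N x) : ℝ) ≤
      ∑ j ∈ range (L + 1), (#(up j) : ℝ) + ∑ j ∈ range L, (#(lay j) : ℝ) + #bot := by
    have h1 := card_le_card hcover
    have h2 := card_union_le ((range (L + 1)).biUnion up ∪ (range L).biUnion lay) bot
    have h3 := card_union_le ((range (L + 1)).biUnion up) ((range L).biUnion lay)
    have h4 : #((range (L + 1)).biUnion up) ≤ _ := card_biUnion_le
    have h5 : #((range L).biUnion lay) ≤ _ := card_biUnion_le
    exact_mod_cast (show _ ≤ _ by omega)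
  have hs1 := Finset.sum_le_card_nsmul _ _ _ hupc
  have hs2 := Finset.sum_le_card_nsmul _ _ _ hlayc
  rw [card_range, nsmul_eq_mul] at hs1 hs2
  push_cast at hs1
  rw [mul_assoc, ← hp]
  linarith

theorem exists_balanced {α ι : Type*} [Fintype α] [Fintype ι] {L d K : ℕ} (N : ι → Finset α)
    (hK : 0 < K) (hd : 0 < d) (hN : ∀ i, #(N i) ≤ d) (hN' : ∀ i, d ≤ K * #(N i))
    (hinc : ∀ v, #(univ.filter fun i => v ∈ N i) ≤ d)
    (hexp : 4 * ((2 * L + 2) * Real.exp (-(d / (4 * K * 2 ^ L)))) * (d * d) ≤ 1) :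
    ∃ x : α → Fin (2 ^ L), ∀ i, BalancedLabelling L d K (N i) x := by
  set bad : ι → Finset (α → Fin (2 ^ L)) := fun i =>
    univ.filter fun x => ¬ BalancedLabelling L d K (N i) x with hbad
  set Γ : ι → Finset ι := fun i => univ.filter fun j => ¬ Disjoint (N i) (N j) with hΓ
  have hΓc : ∀ i, #(Γ i) ≤ d * d := by
    intro i
    have hsub : Γ i ⊆ (N i).biUnion fun v => univ.filter fun j => v ∈ N j := by
      intro j hj
      obtain ⟨v, hv, hv'⟩ := Finset.not_disjoint_iff.1 (mem_filter.1 hj).2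
      exact mem_biUnion.2 ⟨v, hv, by simpa using hv'⟩
    exact (card_le_card hsub).trans ((card_biUnion_le_card_mul _ _ d fun v _ => hinc v).trans
      (Nat.mul_le_mul_right d (hN i)))
  obtain ⟨x, hx⟩ := exists_avoiding_of_local bad Γ (D := d * d)
    (fun i => card_not_balanced_le hK (hN i) (hN' i)) hΓc (Nat.mul_pos hd hd)
    (by push_cast; exact hexp) (by
      intro i J hJ
      refine card_inter_mul_card_of_independent (N i) _ _ ?_ ?_
      · intro x y hxy hx
        simp only [hbad, mem_filter, mem_univ, true_and] at hx ⊢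
        exact fun h => hx (h.congr fun v hv => (hxy v hv).symm)
      · intro x y hxy hx
        simp only [hbad, avoiding, mem_filter, mem_univ, true_and, not_not] at hx ⊢
        intro j hj
        refine (hx j hj).congr fun v hv => hxy v fun hvi => ?_
        refine Finset.disjoint_left.1 hJ hj ?_
        simp only [hΓ, mem_filter, mem_univ, true_and]
        exact Finset.not_disjoint_iff.2 ⟨v, hvi, hv⟩)
  exact ⟨x, fun i => by simpa [hbad] using hx i⟩

/-! ### Removing a dense bipartite subgraph -/

theorem DelSave.of_bipartite [Fintype V] {A B : Finset V} {L a e d K s : ℕ}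
    (hAB : Disjoint A B) (hA : ∀ u ∈ A, ∀ v ∈ A, ¬ G.Adj u v)
    (hB : ∀ u ∈ B, ∀ v ∈ B, ¬ G.Adj u v) (hmax : ∀ v, nbCount G v (A ∪ B) ≤ d)
    (hdA : ∀ u ∈ A, d ≤ K * nbCount G u B) (hdB : ∀ w ∈ B, d ≤ K * nbCount G w A)
    (hK : 0 < K) (ha : 6 * K < 2 ^ a) (he : 32 * K ≤ 2 ^ e) (hL : a + e ≤ L) (hd : 4 ^ L ≤ d)
    (hsq : s + 1 = 2 ^ (L - (a + e)) * (L - a)) (hs : (s + 1) * (4 * K * 2 ^ L) ≤ d)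
    (hexp : 4 * ((2 * L + 2) * Real.exp (-(d / (4 * K * 2 ^ L)))) * (d * d) ≤ 1) :
    DelSave G (A ∪ B) (fun v => nbCount G v (A ∪ B) - s) := by
  have hd0 : 0 < d := lt_of_lt_of_le (by positivity) hd
  have hzA : ∀ u ∈ A, nbCount G u A = 0 := fun u hu => nbCount_eq_zero (hA u hu)
  have hzB : ∀ w ∈ B, nbCount G w B = 0 := fun w hw => nbCount_eq_zero (hB w hw)
  obtain ⟨x, hx⟩ := exists_balanced (L := L) (d := d) (K := K)
    (fun v : ↥(A ∪ B) => (A ∪ B).filter (G.Adj v)) hK hd0 (fun v => hmax v)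
    (by
      rintro ⟨v, hv⟩
      change d ≤ K * nbCount G v (A ∪ B)
      rw [nbCount_union hAB]
      rcases mem_union.1 hv with h | h
      · exact (hdA v h).trans (Nat.mul_le_mul_left _ (Nat.le_add_left _ _))
      · exact (hdB v h).trans (Nat.mul_le_mul_left _ (Nat.le_add_right _ _)))
    (by
      intro v
      refine le_trans ?_ (hmax v)
      refine Finset.card_le_card_of_injOn Subtype.val ?_ Subtype.val_injective.injOn
      rintro ⟨w, hw⟩ hvw
      simp only [coe_filter, Set.mem_ofPred_eq, mem_filter, mem_univ, true_and] at hvw ⊢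
      exact ⟨hw, hvw.2.symm⟩) hexp
  have hcA : ∀ u ∈ A, ∀ T : Finset (Fin (2 ^ L)), nbCount G u (B.filter fun v => x v ∈ T) =
      #(((A ∪ B).filter (G.Adj u)).filter fun v => x v ∈ T) := by
    intro u hu T
    rw [nbCount]
    congr 1
    ext v
    simp only [mem_filter, mem_union]
    have := hA u hu v
    tauto
  have hcB : ∀ w ∈ B, ∀ T : Finset (Fin (2 ^ L)), nbCount G w (A.filter fun v => x v ∈ T) =
      #(((A ∪ B).filter (G.Adj w)).filter fun v => x v ∈ T) := by
    intro w hw T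
    rw [nbCount]
    congr 1
    ext v
    simp only [mem_filter, mem_union]
    have := hB w hw v
    tauto
  have hbot : ∀ v ∈ A ∪ B, s + 1 ≤
      #(((A ∪ B).filter (G.Adj v)).filter fun w => x w ∈ lowLabels L L) := fun v hv =>
    Nat.le_of_mul_le_mul_right (hs.trans (hx ⟨v, hv⟩).2.2) (by positivity)
  have hs2 : 2 * K * s ≤ d := by
    refine le_trans ?_ hs
    have h1 : 1 ≤ 2 ^ L := Nat.one_le_two_pow
    calc 2 * K * s = s * (2 * K * 1) := by ring
      _ ≤ (s + 1) * (4 * K * 2 ^ L) := by gcongr <;> omega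
  refine DelSave.of_layers (SB := B.filter fun v => x v ∈ lowLabels L L)
    (R := fun i => A.filter fun v => x v ∈ lowLabels L i) hAB hA hB (filter_subset _ _)
    (fun i => filter_subset _ _) ?_ ?_ ?_ ?_ ?_ ?_ hdA hs2 ha he hL hd hsq
  · exact fun i v hv => by
      rw [mem_filter] at hv ⊢
      exact ⟨hv.1, lowLabels_succ_subset L i hv.2⟩
  · intro u hu
    rw [hcA u hu]
    exact (hx ⟨u, mem_union_left _ hu⟩).1 L le_rfl
  · intro u hu
    rw [hcA u hu]
    exact hbot u (mem_union_left _ hu)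
  · intro w hw i hi
    rw [hcB w hw]
    exact (hx ⟨w, mem_union_right _ hw⟩).1 i hi
  · intro w hw
    rw [hcB w hw]
    exact hbot w (mem_union_right _ hw)
  · intro w hw i hi
    have hset : (A.filter fun v => x v ∈ lowLabels L i) \
        (A.filter fun v => x v ∈ lowLabels L (i + 1)) =
        A.filter fun v => x v ∈ lowLabels L i \ lowLabels L (i + 1) := by
      ext v
      simp only [mem_sdiff, mem_filter]
      tauto
    rw [hset, hcB w hw]
    exact (hx ⟨w, mem_union_right _ hw⟩).2.1 i hi

/-! ### Graphs of bounded degree and bounded chromatic number -/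

theorem DelSave.of_coloring [Fintype V] {r d s s₀ L a e : ℕ} (C : G.Coloring (Fin r))
    (hr : 0 < r) (hmax : ∀ v, nbCount G v univ ≤ d) (ha : 6 * (8 * r) < 2 ^ a)
    (he : 32 * (8 * r) ≤ 2 ^ e) (hL : a + e ≤ L) (hd : 4 ^ L ≤ d)
    (hsq : s + 1 = 2 ^ (L - (a + e)) * (L - a)) (hs : (s + 1) * (4 * (8 * r) * 2 ^ L) ≤ d)
    (hexp : 4 * ((2 * L + 2) * Real.exp (-(d / (4 * (8 * r : ℕ) * 2 ^ L)))) * (d * d) ≤ 1)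
    (hs₀ : s₀ ≤ s) (U : Finset V) : DelSave G U (fun _ => d - s₀) := by
  have hd0 : 0 < d := lt_of_lt_of_le (by positivity) hd
  have hs2 : 2 * s ≤ d := by
    refine le_trans ?_ hs
    have h1 : 1 ≤ 2 ^ L := Nat.one_le_two_pow
    calc 2 * s = s * (2 * 1) := by ring
      _ ≤ (s + 1) * (4 * (8 * r) * 2 ^ L) := by gcongr <;> omega
  induction U using Finset.strongInduction with
  | H U ih =>
    by_cases hlow : ∃ v ∈ U, nbCount G v U < d - s₀
    · obtain ⟨v, hv, hlt⟩ := hlow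
      have := (ih (U.erase v) (erase_ssubset hv)).union (W := {v}) (fun _ => d - s₀) (by simp)
        (fun _ _ => rfl) (DelSave.of_indep (by simp) (by
          intro w hw
          rw [mem_singleton] at hw
          subst hw
          have := nbCount_mono (G := G) (v := w) (erase_subset w U)
          omega))
      rwa [union_comm, ← insert_eq, insert_erase hv] at this
    · push Not at hlow
      rcases U.eq_empty_or_nonempty with rfl | hU
      · exact DelSave.empty _
      obtain ⟨A, B, hAU, hBU, hne, hAB, hA, hB, hdA, hdB⟩ :=
        exists_dense_bipartite C hU (by omega) hlow
      have hhalf : d ≤ 2 * (d - s₀) := by omega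
      have hW : A ∪ B ⊆ U := union_subset hAU hBU
      have hbip : DelSave G (A ∪ B) (fun v => nbCount G v (A ∪ B) - s) :=
        DelSave.of_bipartite hAB hA hB (fun v => (nbCount_mono (subset_univ _)).trans (hmax v))
          (fun u hu => by linarith [hdA u hu])
          (fun u hu => by linarith [hdB u hu]) (by omega) ha he hL hd hsq hs hexp
      have := (ih (U \ (A ∪ B)) (sdiff_ssubset hW hne)).union (W := A ∪ B) (fun _ => d - s₀)
        sdiff_disjoint (fun _ _ => rfl) (hbip.mono fun v _ => by
          have h1 := nbCount_sdiff_add (G := G) (v := v) hW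
          have h2 := (nbCount_mono (G := G) (v := v) (subset_univ U)).trans (hmax v)
          omega)
      rwa [sdiff_union_of_subset hW] at this

/-! ### Choice of the scale -/

theorem exists_scale (K a e : ℕ) (hK : 0 < K) (he : 32 * K ≤ 2 ^ e) :
    ∃ (d₀ : ℕ) (c : ℝ), 0 < c ∧ ∀ d : ℕ, d₀ ≤ d → ∃ L s : ℕ, a + e ≤ L ∧ 4 ^ L ≤ d ∧
      s + 1 = 2 ^ (L - (a + e)) * (L - a) ∧ (s + 1) * (4 * K * 2 ^ L) ≤ d ∧
      4 * ((2 * L + 2) * Real.exp (-(d / (4 * K * 2 ^ L)))) * (d * d) ≤ 1 ∧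
      ⌊c * Real.sqrt (d * Real.log d)⌋₊ ≤ s := by
  have hK' : (1 : ℝ) ≤ K := by exact_mod_cast hK
  obtain ⟨M, hM1, hMK, hMae⟩ : ∃ M : ℝ, 1 ≤ M ∧ 16 * K ≤ M ∧ 2 ^ (a + e + 1) ≤ M :=
    ⟨16 * K + 2 ^ (a + e + 1), by
      have : (0 : ℝ) < 2 ^ (a + e + 1) := by positivity
      linarith, by
      have : (0 : ℝ) < 2 ^ (a + e + 1) := by positivity
      linarith, by linarith⟩
  have hlog := (isLittleO_log_rpow_atTop (r := 1 / 2) (by norm_num)).bound one_pos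
  have hev : ∀ᶠ t : ℝ in Filter.atTop, 8 ≤ t ∧ M ^ 4 ≤ t ∧ 8 * (a + 1) ≤ Real.log t ∧
      ‖Real.log t‖ ≤ 1 * ‖t ^ (1 / 2 : ℝ)‖ := by
    filter_upwards [Filter.eventually_ge_atTop 8, Filter.eventually_ge_atTop (M ^ 4),
      Real.tendsto_log_atTop.eventually_ge_atTop (8 * (a + 1) : ℝ), hlog] with t h1 h2 h3 h4
    exact ⟨h1, h2, h3, h4⟩
  obtain ⟨d₀, hd₀⟩ := Filter.eventually_atTop.1
    ((tendsto_natCast_atTop_atTop (R := ℝ)).eventually hev)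
  refine ⟨d₀, 1 / 2 ^ (a + e + 5), by positivity, fun d hd => ?_⟩
  obtain ⟨hd8, hdM, hx8, hxd⟩ := hd₀ d hd
  set x := Real.log d with hx
  have hdpos : (0 : ℝ) < d := by linarith
  have hx1 : 1 ≤ x := by
    have : (0 : ℝ) ≤ a := Nat.cast_nonneg a
    linarith
  have hx0 : 0 < x := by linarith
  have hxsq : x ^ 2 ≤ d := by
    rw [← Real.sqrt_eq_rpow, Real.norm_of_nonneg hx0.le,
      Real.norm_of_nonneg (Real.sqrt_nonneg _), one_mul] at hxd
    exact (Real.le_sqrt' hx0).1 hxd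
  set y := Real.sqrt (d / x) with hy
  have hyy : y ^ 2 * x = d := by
    rw [hy, Real.sq_sqrt (by positivity)]
    field_simp
  have hy0 : 0 < y := Real.sqrt_pos.2 (by positivity)
  have hy4 : d ≤ y ^ 4 := by
    have h1 : y ^ 4 * x ^ 2 = d ^ 2 := by rw [← hyy]; ring
    have h2 : y ^ 4 * x ^ 2 ≤ y ^ 4 * d := by gcongr
    nlinarith
  have hyM : M ≤ y := le_of_pow_le_pow_left₀ four_ne_zero hy0.le (hdM.trans hy4)
  obtain ⟨L, hLle, hLlt⟩ := exists_nat_pow_near (hM1.trans hyM) (one_lt_two (α := ℝ))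
  have haeL : a + e < L := by
    have : (2 : ℝ) ^ (a + e + 1) < 2 ^ (L + 1) := hMae.trans_lt (hyM.trans_lt hLlt)
    have := (pow_lt_pow_iff_right₀ (one_lt_two (α := ℝ))).1 this
    omega
  have h4L : (4 : ℝ) ^ L * x ≤ d := by
    rw [← hyy, show (4 : ℝ) = 2 ^ 2 by norm_num, ← pow_mul, mul_comm 2 L, pow_mul]
    gcongr
  have h4Ld : (4 : ℝ) ^ L ≤ d := by
    have : (0 : ℝ) < 4 ^ L := by positivity
    nlinarith
  have hLx : (L : ℝ) ≤ x := by
    have h1 := Real.log_le_log (by positivity) h4Ld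
    rw [Real.log_pow, show (4 : ℝ) = 2 ^ 2 by norm_num, Real.log_pow] at h1
    have h2 := Real.log_two_gt_d9
    have h3 : (0 : ℝ) ≤ L := Nat.cast_nonneg L
    push_cast at h1
    nlinarith
  have hxL : x ≤ 4 * (L + 1) := by
    have h1 : (d : ℝ) ≤ 2 ^ (4 * (L + 1)) := by
      rw [mul_comm, pow_mul]
      exact hy4.trans (by gcongr)
    have h2 := Real.log_le_log hdpos h1
    rw [Real.log_pow] at h2
    have h3 := Real.log_two_lt_d9
    have h4 : (0 : ℝ) ≤ L := Nat.cast_nonneg L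
    push_cast at h2
    nlinarith
  have hLa : x / 8 ≤ ((L - a : ℕ) : ℝ) := by
    rw [Nat.cast_sub (by omega)]
    linarith
  have hpos : 0 < 2 ^ (L - (a + e)) * (L - a) := Nat.mul_pos (by positivity) (by omega)
  have hq : (2 : ℝ) ^ (L - (a + e)) * 2 ^ (a + e) = 2 ^ L := by
    rw [← pow_add]
    congr 1
    omega
  refine ⟨L, 2 ^ (L - (a + e)) * (L - a) - 1, haeL.le, by exact_mod_cast h4Ld, by omega, ?_, ?_, ?_⟩
  · rw [Nat.sub_add_cancel hpos]
    have h1 : 4 * K ≤ 2 ^ (a + e) := by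
      rw [pow_add]
      have : 1 ≤ 2 ^ a := Nat.one_le_two_pow
      nlinarith
    have h2 : (4 * K : ℝ) ≤ 2 ^ (a + e) := by exact_mod_cast h1
    have h3 : ((L - a : ℕ) : ℝ) ≤ x := by
      rw [Nat.cast_sub (by omega)]
      have : (0 : ℝ) ≤ a := Nat.cast_nonneg a
      linarith
    have : (2 : ℝ) ^ (L - (a + e)) * (L - a : ℕ) * (4 * K * 2 ^ L) ≤ d := by
      calc (2 : ℝ) ^ (L - (a + e)) * (L - a : ℕ) * (4 * K * 2 ^ L)
          ≤ 2 ^ (L - (a + e)) * x * (2 ^ (a + e) * 2 ^ L) := by gcongr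
        _ = (2 ^ (L - (a + e)) * 2 ^ (a + e)) * 2 ^ L * x := by ring
        _ = 4 ^ L * x := by rw [hq, ← mul_pow]; norm_num
        _ ≤ d := h4L
    exact_mod_cast this
  · have h1 : 4 * x ≤ d / (4 * K * 2 ^ L) := by
      rw [le_div_iff₀ (by positivity), ← hyy]
      calc 4 * x * (4 * K * 2 ^ L) ≤ 4 * x * (4 * K * y) := by gcongr
        _ = 16 * K * (x * y) := by ring
        _ ≤ y * (x * y) := by gcongr; exact hMK.trans hyM
        _ = y ^ 2 * x := by ring
    have h2 : Real.exp (-(d / (4 * K * 2 ^ L))) ≤ ((d : ℝ) ^ 4)⁻¹ := by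
      have h3 : Real.exp (4 * x) = (d : ℝ) ^ 4 := by
        have := Real.exp_nat_mul x 4
        rw [hx, Real.exp_log hdpos] at this
        exact_mod_cast this
      rw [← h3, ← Real.exp_neg]
      gcongr
    have h4 : (2 * L + 2 : ℝ) ≤ 2 * d := by
      have := Real.log_le_sub_one_of_pos hdpos
      linarith
    calc 4 * ((2 * L + 2) * Real.exp (-(d / (4 * K * 2 ^ L)))) * (d * d)
        ≤ 4 * ((2 * d) * ((d : ℝ) ^ 4)⁻¹) * (d * d) := by gcongr
      _ = 8 / d := by field_simp; norm_num
      _ ≤ 1 := by rw [div_le_one hdpos]; exact hd8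
  · have h1 : Real.sqrt (d * x) = x * y := by
      rw [← hyy, show y ^ 2 * x * x = (x * y) ^ 2 by ring, Real.sqrt_sq (by positivity)]
    have h2 : 1 / 2 ^ (a + e + 5) * Real.sqrt (d * x) <
        ((2 ^ (L - (a + e)) * (L - a) : ℕ) : ℝ) := by
      rw [h1]
      push_cast
      have h3 : y < 2 ^ (L - (a + e)) * 2 ^ (a + e) * 2 := by
        rw [hq, ← pow_succ]
        exact hLlt
      calc 1 / 2 ^ (a + e + 5) * (x * y)
          < 1 / 2 ^ (a + e + 5) * (x * (2 ^ (L - (a + e)) * 2 ^ (a + e) * 2)) := by gcongr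
        _ = 2 ^ (L - (a + e)) * (x / 16) := by
          rw [pow_add _ (a + e) 5]
          field_simp
          norm_num
        _ ≤ 2 ^ (L - (a + e)) * (L - a : ℕ) := by gcongr; linarith
    have := (Nat.floor_lt' hpos.ne').2 h2
    omega

end

/-- For each `r ≥ 2` there are `d₀` and `c > 0` such that for all
`d ≥ d₀`, every graph of maximum degree at most `d` and chromatic number at most `r`
satisfies `sd³(G) ≤ d - ⌊c·√(d log d)⌋`, and hence `χ_DPP(G) ≤ d - ⌊c·√(d log d)⌋`. -/
theorem statement17 (r : ℕ) (hr : 2 ≤ r) :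
    ∃ (d₀ : ℕ) (c : ℝ), 0 < c ∧ ∀ d : ℕ, d₀ ≤ d →
      ∀ (V : Type) [Fintype V] (G : SimpleGraph V) [DecidableRel G.Adj],
        G.Colorable r →
        (∀ v, G.degree v ≤ d) →
        sd3 G ≤ d - ⌊c * Real.sqrt (d * Real.log d)⌋₊ ∧
        chiDPP G ≤ d - ⌊c * Real.sqrt (d * Real.log d)⌋₊ := by
  obtain ⟨a, ha⟩ := pow_unbounded_of_one_lt (6 * (8 * r)) one_lt_two
  obtain ⟨e, he⟩ := pow_unbounded_of_one_lt (32 * (8 * r)) one_lt_two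
  obtain ⟨d₀, c, hc, hscale⟩ := exists_scale (8 * r) a e (by omega) he.le
  refine ⟨d₀, c, hc, fun d hd V _ G _ hcol hdeg => ?_⟩
  obtain ⟨C⟩ := hcol
  obtain ⟨L, s, hL, hd4, hsq, hs, hexp, hs₀⟩ := hscale d hd
  have hmax : ∀ v, nbCount G v Finset.univ ≤ d := by
    intro v
    refine le_trans (le_of_eq ?_) (hdeg v)
    rw [nbCount, ← G.card_neighborFinset_eq_degree]
    congr 1
    ext w
    simp
  have h := DelSave.of_coloring C (by omega) hmax ha he.le hL hd4 hsq hs hexp hs₀ Finset.univ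
  exact ⟨Nat.sInf_le h.sd3, Nat.sInf_le h.dpPaint⟩
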